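/- Let (L; γ, H, ν, δ, ε) be an auxiliary structure such that ν is antisymmetric and (H; ν) is an order ideal (a nonempty down-set, with the restricted order) of a bounded ordered set (H*; ν*). Then there exists an auxiliary structure (L*; γ*, H*, ν*, δ*, ε*), with underlying quasiordered set exactly (H*; ν*), such that (L; γ, H, ν, δ, ε) is a substructure of (L*; γ*, H*, ν*, δ*, ε*); furthermore, if (L; γ, H, ν, δ, ε) is countable and H* is countable, then (L*; γ*, H*, ν*, δ*, ε*) is countable. -/

import Mathlib

/-- A lattice congruence: an equivalence relation compatible with meet and join. -/
def IsLatCon {L : Type*} [Lattice L] (r : L → L → Prop) : Prop :=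
  Equivalence r ∧
  (∀ a b c d, r a b → r c d → r (a ⊓ c) (b ⊓ d)) ∧
  (∀ a b c d, r a b → r c d → r (a ⊔ c) (b ⊔ d))

/-- The principal congruence generated by the pair `(a, b)`:
the smallest congruence relating `a` and `b`. -/
def cg {L : Type*} [Lattice L] (a b : L) (x y : L) : Prop :=
  ∀ r : L → L → Prop, IsLatCon r → r a b → r x y

/-- The ordered set of principal congruences of `L`, ordered by inclusion. -/
def Princ (L : Type*) [Lattice L] : Type _ :=
  {θ : L → L → Prop // ∃ a b : L, θ = cg a b}

instance (L : Type*) [Lattice L] : PartialOrder (Princ L) :=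
  inferInstanceAs (PartialOrder {θ : L → L → Prop // ∃ a b : L, θ = cg a b})
/-- `(L; γ, H, ν)` is a quasi-colored lattice: `ν` is reflexive and transitive, `γ` is
surjective onto `H` via ordered pairs, and conditions (C1), (C2) hold for all ordered
pairs. (Here `γ` is given as a total map whose values only matter on ordered pairs.) -/
def IsQuasiColored {L H : Type*} [Lattice L] (γ : L → L → H) (ν : H → H → Prop) : Prop :=
  Reflexive ν ∧ Transitive ν ∧
  (∀ h : H, ∃ x y : L, x ≤ y ∧ γ x y = h) ∧
  (∀ u₁ v₁ u₂ v₂ : L, u₁ ≤ v₁ → u₂ ≤ v₂ → ν (γ u₁ v₁) (γ u₂ v₂) →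
    ∀ x y : L, cg u₁ v₁ x y → cg u₂ v₂ x y) ∧
  (∀ u₁ v₁ u₂ v₂ : L, u₁ ≤ v₁ → u₂ ≤ v₂ →
    (∀ x y : L, cg u₁ v₁ x y → cg u₂ v₂ x y) → ν (γ u₁ v₁) (γ u₂ v₂))

/-- The congruence generated by a set of pairs, as the least congruence containing it. -/
def cgSet {L : Type*} [Lattice L] (S : Set (L × L)) (x y : L) : Prop :=
  ∀ r : L → L → Prop, IsLatCon r → (∀ w ∈ S, r w.1 w.2) → r x y

/-- The least reflexive transitive relation (quasiorder) containing `R`. -/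
def quoClosure {H : Type*} (R : H → H → Prop) (x y : H) : Prop :=
  ∀ μ : H → H → Prop, Reflexive μ → Transitive μ → (∀ a b : H, R a b → μ a b) → μ x y

/-- `(a₁, b₁, a₂, b₂)` is an N₆-quadruple of `L`. -/
def IsN6 {L : Type*} [Lattice L] (a₁ b₁ a₂ b₂ : L) : Prop :=
  a₁ < b₁ ∧ a₂ < b₂ ∧ a₁ ⊓ a₂ = b₁ ⊓ b₂ ∧ a₁ ⊔ a₂ = b₁ ⊔ b₂ ∧
  ({a₁ ⊓ a₂, a₁, b₁, a₂, b₂, a₁ ⊔ a₂} : Set L).ncard = 6 ∧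
  SupClosed ({a₁ ⊓ a₂, a₁, b₁, a₂, b₂, a₁ ⊔ a₂} : Set L) ∧
  InfClosed ({a₁ ⊓ a₂, a₁, b₁, a₂, b₂, a₁ ⊔ a₂} : Set L)

/-- A spanning N₆-quadruple: an N₆-quadruple with `b₁ ⊓ b₂ = 0_L` and `a₁ ⊔ a₂ = 1_L`. -/
def IsSpanningN6 {L : Type*} [Lattice L] (a₁ b₁ a₂ b₂ : L) : Prop :=
  IsN6 a₁ b₁ a₂ b₂ ∧ IsBot (b₁ ⊓ b₂) ∧ IsTop (a₁ ⊔ a₂)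

/-- A strong N₆-quadruple: a spanning one satisfying the extra join/meet conditions. -/
def IsStrongN6 {L : Type*} [Lattice L] (a₁ b₁ a₂ b₂ : L) : Prop :=
  IsSpanningN6 a₁ b₁ a₂ b₂ ∧
  (∀ x : L, b₁ ⊓ b₂ < x → x ≤ b₁ → x ⊔ a₂ = a₁ ⊔ a₂) ∧
  (∀ x : L, b₁ ⊓ b₂ < x → x ≤ b₂ → x ⊔ a₁ = a₁ ⊔ a₂) ∧
  (∀ x : L, a₁ ≤ x → x < a₁ ⊔ a₂ → x ⊓ b₂ = b₁ ⊓ b₂) ∧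
  (∀ x : L, a₂ ≤ x → x < a₁ ⊔ a₂ → x ⊓ b₁ = b₁ ⊓ b₂)

/-- An auxiliary structure `(L; γ, H, ν, δ, ε)`, conditions (A1)–(A8). -/
structure AuxStr (L : Type*) (H : Type*) [Lattice L] where
  γ : L → L → H
  ν : H → H → Prop
  δ : H → L
  ε : H → L
  /-- `0_H`, the least element of `(H; ν)`. -/
  zero : H
  /-- (A1): `(L; γ, H, ν)` is a quasi-colored lattice. -/
  quasi : IsQuasiColored γ ν
  /-- (A2): `0_H` is a least element … -/
  zero_least : ∀ x : H, ν zero x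
  /-- (A2): … and it is the only least element … -/
  least_unique : ∀ z : H, (∀ x : H, ν z x) → z = zero
  /-- (A2): … and `(H; ν)` has at most one greatest element. -/
  greatest_unique : ∀ g₁ g₂ : H, (∀ x : H, ν x g₁) → (∀ x : H, ν x g₂) → g₁ = g₂
  /-- (A3): `δ 0_H = ε 0_H` … -/
  delta_zero : δ zero = ε zero
  /-- (A3): … and `δ x ≺ ε x` for `x ≠ 0_H`. -/
  delta_covby : ∀ x : H, x ≠ zero → δ x ⋖ ε x
  /-- (A4): `γ (δ p) (ε p) = p`. -/
  gamma_delta : ∀ p : H, γ (δ p) (ε p) = p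
  /-- (A5): distinct nonzero colors give N₆-quadruples. -/
  n6 : ∀ p q : H, p ≠ zero → q ≠ zero → p ≠ q → IsN6 (δ p) (ε p) (δ q) (ε q)
  /-- (A6): for `ν`-incomparable `p, q`, spanning N₆-quadruples are strong. -/
  strong : ∀ p q : H, ¬ ν p q → ¬ ν q p →
    IsSpanningN6 (δ p) (ε p) (δ q) (ε q) → IsStrongN6 (δ p) (ε p) (δ q) (ε q)
  /-- (A7): if `L` is bounded with `|L| > 1`, there are at least three doubly-covering
  complements of everything else. -/
  atoms3 : ∀ bot top : L, IsBot bot → IsTop top → bot ≠ top →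
    ∃ x₁ x₂ x₃ : L, x₁ ≠ x₂ ∧ x₁ ≠ x₃ ∧ x₂ ≠ x₃ ∧
      ∀ x ∈ ({x₁, x₂, x₃} : Set L), bot ⋖ x ∧ x ⋖ top ∧
        ∀ y : L, y ≠ bot → y ≠ top → y ≠ x → x ⊓ y = bot ∧ x ⊔ y = top
  /-- (A8): if `H` has a greatest element `1_H` and `|L| > 1`, the congruence generated
  by the pairs `(δ p, ε p)`, `p ≠ 1_H`, is not the full congruence. -/
  notfull : ∀ one : H, (∀ x : H, ν x one) → (∃ a b : L, a ≠ b) →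
    ∃ x y : L, ¬ cgSet {w : L × L | ∃ p : H, p ≠ one ∧ w = (δ p, ε p)} x y

/-- A substructure embedding of auxiliary structures: `f` embeds `L₁` as a sublattice
of `L₂`, `g` embeds `H₁` into `H₂` with `ν₁ ⊆ ν₂` and `0` preserved, and `γ`, `δ`, `ε`
of the small structure are the restrictions of those of the big one. -/
structure AuxSub {L₁ H₁ L₂ H₂ : Type*} [Lattice L₁] [Lattice L₂]
    (A : AuxStr L₁ H₁) (B : AuxStr L₂ H₂) where
  f : L₁ → L₂
  g : H₁ → H₂
  f_inj : Function.Injective f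
  g_inj : Function.Injective g
  f_inf : ∀ x y : L₁, f (x ⊓ y) = f x ⊓ f y
  f_sup : ∀ x y : L₁, f (x ⊔ y) = f x ⊔ f y
  g_zero : g A.zero = B.zero
  nu_mono : ∀ x y : H₁, A.ν x y → B.ν (g x) (g y)
  gamma_comm : ∀ x y : L₁, x ≤ y → B.γ (f x) (f y) = g (A.γ x y)
  delta_comm : ∀ p : H₁, f (A.δ p) = B.δ (g p)
  eps_comm : ∀ p : H₁, f (A.ε p) = B.ε (g p)
universe u v w

/-! ### Linked sums of lattices -/

/-- A partial rule for joining elements of different members of a family of lattices: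
`link c c' x y` is the `c`-component of the join of `x : D c` and `y : D c'`, and `none`
means that this join is the top element. -/
structure LinkSystem (Γ : Type w) (D : Γ → Type u) [∀ c, Lattice (D c)] where
  link : ∀ c c' : Γ, D c → D c' → Option (D c)
  link_symm : ∀ {c c' : Γ} {x : D c} {y : D c'}, link c c' x y = none → link c' c y x = none
  le_link : ∀ {c c' : Γ} {x : D c} {y : D c'} {z : D c}, link c c' x y = some z → x ≤ z
  link_mono : ∀ {c c' : Γ} {x x' : D c} {y y' : D c'} {z' : D c}, x ≤ x' → y ≤ y' →
    link c c' x' y' = some z' → ∃ z, link c c' x y = some z ∧ z ≤ z'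
  link_link : ∀ {c c' : Γ} {x z : D c} {y w : D c'},
    link c c' x y = some z → link c' c y x = some w → link c c' z w = some z

namespace LinkSystem

variable {Γ : Type w} {D : Γ → Type u} [∀ c, Lattice (D c)] (S : LinkSystem Γ D)

/-- Tuples that lie below some proper element: the support has at most two elements, and two
elements of the support are linked. -/
structure Good (s : ∀ c, WithBot (D c)) : Prop where
  support : ∀ a b c, s a ≠ ⊥ → s b ≠ ⊥ → s c ≠ ⊥ → a = b ∨ a = c ∨ b = c
  linked : ∀ (a b : Γ) (x : D a) (y : D b), a ≠ b → s a = x → s b = y → S.link a b x y ≠ none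

open Classical in
/-- The closure of a good tuple. -/
noncomputable def close (s : ∀ c, WithBot (D c)) (c : Γ) : WithBot (D c) :=
  if h : ∃ (z : D c) (c' : Γ) (x : D c) (y : D c'),
      c ≠ c' ∧ s c = x ∧ s c' = y ∧ S.link c c' x y = some z
    then (h.choose : D c) else s c

variable {S} {s t : ∀ c, WithBot (D c)}

theorem Good.close_eq (hs : S.Good s) {c c' : Γ} {x z : D c} {y : D c'} (hne : c ≠ c')
    (hx : s c = x) (hy : s c' = y) (hz : S.link c c' x y = some z) : S.close s c = z := by
  have h : ∃ (z : D c) (c' : Γ) (x : D c) (y : D c'),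
      c ≠ c' ∧ s c = x ∧ s c' = y ∧ S.link c c' x y = some z := ⟨z, c', x, y, hne, hx, hy, hz⟩
  rw [close, dif_pos h]
  obtain ⟨c'', x', y', hne', hx', hy', hz'⟩ := h.choose_spec
  have hc : c' = c'' := by
    rcases hs.support c c' c'' (by simp [hx]) (by simp [hy]) (by simp [hy']) with h | h | h
    exacts [absurd h hne, absurd h hne', h]
  subst hc
  rw [hx, WithBot.coe_inj] at hx'
  rw [hy, WithBot.coe_inj] at hy'
  subst hx' hy'
  rw [hz, Option.some_inj] at hz'
  rw [← hz']

theorem close_eq_self {c : Γ} (h : ∀ c', c' ≠ c → s c' = ⊥) : S.close s c = s c := by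
  rw [close, dif_neg]
  rintro ⟨z, c', x, y, hne, -, hy, -⟩
  simp [h c' hne.symm] at hy

theorem close_eq_bot {c : Γ} (h : s c = ⊥) : S.close s c = ⊥ := by
  rw [close, dif_neg, h]
  rintro ⟨z, c', x, y, -, hx, -⟩
  simp [h] at hx

theorem Good.mono (ht : S.Good t) (h : s ≤ t) : S.Good s := by
  have hb : ∀ a, s a ≠ ⊥ → t a ≠ ⊥ := fun a ha hta => ha (le_bot_iff.1 (hta ▸ h a))
  refine ⟨fun a b c ha hb' hc => ht.support a b c (hb a ha) (hb b hb') (hb c hc), ?_⟩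
  intro a b x y hne hx hy hn
  obtain ⟨x', hx'⟩ := WithBot.ne_bot_iff_exists.1 (hb a (by simp [hx]))
  obtain ⟨y', hy'⟩ := WithBot.ne_bot_iff_exists.1 (hb b (by simp [hy]))
  obtain ⟨z', hz'⟩ := Option.ne_none_iff_exists'.1 (ht.linked a b x' y' hne hx'.symm hy'.symm)
  have h1 := h a
  have h2 := h b
  rw [hx, ← hx', WithBot.coe_le_coe] at h1
  rw [hy, ← hy', WithBot.coe_le_coe] at h2
  obtain ⟨z, hz, -⟩ := S.link_mono h1 h2 hz'
  simp [hz] at hn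

/-- The value of the closure at a point of the support. -/
theorem Good.close_cases (hs : S.Good s) {c : Γ} {x : D c} (hx : s c = x) :
    ((∀ c', c' ≠ c → s c' = ⊥) ∧ S.close s c = x) ∨
    ∃ (c' : Γ) (y : D c') (z : D c), c ≠ c' ∧ s c' = y ∧ S.link c c' x y = some z ∧
      S.close s c = z := by
  by_cases h : ∀ c', c' ≠ c → s c' = ⊥
  · exact Or.inl ⟨h, (close_eq_self h).trans hx⟩
  · push Not at h
    obtain ⟨c', hne, hc'⟩ := h
    obtain ⟨y, hy⟩ := WithBot.ne_bot_iff_exists.1 hc'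
    obtain ⟨z, hz⟩ := Option.ne_none_iff_exists'.1 (hs.linked c c' x y hne.symm hx hy.symm)
    exact Or.inr ⟨c', y, z, hne.symm, hy.symm, hz, hs.close_eq hne.symm hx hy.symm hz⟩

theorem Good.le_close (hs : S.Good s) : s ≤ S.close s := by
  intro c
  rcases h : s c with _ | x
  · exact bot_le
  · rcases hs.close_cases h with ⟨-, h'⟩ | ⟨c', y, z, -, -, hz, h'⟩
    · exact h'.ge
    · rw [h']
      exact WithBot.coe_le_coe.2 (S.le_link hz)

theorem Good.close_mono (ht : S.Good t) (h : s ≤ t) : S.close s ≤ S.close t := by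
  have hs := ht.mono h
  intro c
  rcases hc : s c with _ | x
  · rw [close_eq_bot hc]; exact bot_le
  · rcases hs.close_cases hc with ⟨-, h'⟩ | ⟨c', y, z, hne, hy, hz, h'⟩
    · rw [h']
      exact hc.ge.trans ((h c).trans (ht.le_close c))
    · have hx' := h c
      have hy' := h c'
      rw [hy] at hy'
      erw [hc] at hx'
      obtain ⟨x', hx1, hx2⟩ := WithBot.coe_le_iff.1 hx'
      obtain ⟨y', hy1, hy2⟩ := WithBot.coe_le_iff.1 hy'
      obtain ⟨z', hz'⟩ := Option.ne_none_iff_exists'.1 (ht.linked c c' x' y' hne hx1 hy1)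
      obtain ⟨z'', hz1, hz2⟩ := S.link_mono hx2 hy2 hz'
      rw [h', ht.close_eq hne hx1 hy1 hz']
      rw [hz1, Option.some_inj] at hz
      exact WithBot.coe_le_coe.2 (hz ▸ hz2)

theorem ne_bot_of_close {c : Γ} (h : S.close s c ≠ ⊥) : s c ≠ ⊥ :=
  fun h' => h (close_eq_bot h')

theorem Good.link_close (hs : S.Good s) {a b : Γ} {x : D a} {y : D b} (hne : a ≠ b)
    (hx : S.close s a = x) (hy : S.close s b = y) : S.link a b x y = some x := by
  obtain ⟨x', hx'⟩ := WithBot.ne_bot_iff_exists.1 (ne_bot_of_close (S := S) (s := s) (c := a) (by simp [hx]))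
  obtain ⟨y', hy'⟩ := WithBot.ne_bot_iff_exists.1 (ne_bot_of_close (S := S) (s := s) (c := b) (by simp [hy]))
  obtain ⟨z, hz⟩ := Option.ne_none_iff_exists'.1 (hs.linked a b x' y' hne hx'.symm hy'.symm)
  obtain ⟨w, hw⟩ :=
    Option.ne_none_iff_exists'.1 (hs.linked b a y' x' hne.symm hy'.symm hx'.symm)
  rw [hs.close_eq hne hx'.symm hy'.symm hz, WithBot.coe_inj] at hx
  rw [hs.close_eq hne.symm hy'.symm hx'.symm hw, WithBot.coe_inj] at hy
  subst hx hy
  exact S.link_link hz hw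

theorem Good.good_close (hs : S.Good s) : S.Good (S.close s) := by
  refine ⟨fun a b c ha hb hc => hs.support a b c (ne_bot_of_close ha) (ne_bot_of_close hb)
    (ne_bot_of_close hc), ?_⟩
  intro a b x y hne hx hy
  simp [hs.link_close hne hx hy]

theorem Good.close_close (hs : S.Good s) : S.close (S.close s) = S.close s := by
  funext c
  rcases hc : S.close s c with _ | x
  · exact close_eq_bot hc
  · rcases hs.good_close.close_cases hc with ⟨-, h'⟩ | ⟨c', y, z, hne, hy, hz, h'⟩
    · exact h'
    · rw [hs.link_close hne hc hy, Option.some_inj] at hz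
      rw [h', ← hz]
      rfl

variable (S)

open Classical in
/-- The closure operator whose closed elements form the linked sum. -/
noncomputable def cl (m : WithTop (∀ c, WithBot (D c))) : WithTop (∀ c, WithBot (D c)) :=
  WithTop.recTopCoe ⊤ (fun s => if S.Good s then ((S.close s : ∀ c, WithBot (D c)) :
    WithTop (∀ c, WithBot (D c))) else ⊤) m

theorem cl_top : S.cl ⊤ = ⊤ := rfl

theorem cl_of_good (hs : S.Good s) : S.cl (s : WithTop (∀ c, WithBot (D c))) = S.close s := by
  simp [cl, hs]

theorem cl_of_not_good (hs : ¬ S.Good s) : S.cl (s : WithTop (∀ c, WithBot (D c))) = ⊤ := by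
  simp [cl, hs]

theorem le_cl (m : WithTop (∀ c, WithBot (D c))) : m ≤ S.cl m := by
  induction m using WithTop.recTopCoe with
  | top => exact le_rfl
  | coe s =>
    by_cases hs : S.Good s
    · rw [S.cl_of_good hs]
      exact WithTop.coe_le_coe.2 hs.le_close
    · rw [S.cl_of_not_good hs]
      exact le_top

theorem cl_mono {m n : WithTop (∀ c, WithBot (D c))} (h : m ≤ n) : S.cl m ≤ S.cl n := by
  induction n using WithTop.recTopCoe with
  | top => exact le_top
  | coe t =>
    by_cases ht : S.Good t
    · obtain ⟨s, rfl, hst⟩ := WithTop.le_coe_iff.1 h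
      rw [S.cl_of_good ht, S.cl_of_good (ht.mono hst)]
      exact WithTop.coe_le_coe.2 (ht.close_mono hst)
    · rw [S.cl_of_not_good ht]
      exact le_top

theorem cl_cl (m : WithTop (∀ c, WithBot (D c))) : S.cl (S.cl m) = S.cl m := by
  induction m using WithTop.recTopCoe with
  | top => rfl
  | coe s =>
    by_cases hs : S.Good s
    · rw [S.cl_of_good hs, S.cl_of_good hs.good_close, hs.close_close]
    · rw [S.cl_of_not_good hs, cl_top]

/-- The linked sum: the closed elements, ordered componentwise. -/
def Sum : Type (max u w) := {m : WithTop (∀ c, WithBot (D c)) // S.cl m = m}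

noncomputable instance : Lattice S.Sum where
  le x y := x.1 ≤ y.1
  le_refl x := le_refl x.1
  le_trans x y z := le_trans (a := x.1)
  le_antisymm x y h h' := Subtype.ext (le_antisymm h h')
  sup x y := ⟨S.cl (x.1 ⊔ y.1), S.cl_cl _⟩
  inf x y := ⟨x.1 ⊓ y.1, le_antisymm (le_inf ((S.cl_mono inf_le_left).trans x.2.le)
    ((S.cl_mono inf_le_right).trans y.2.le)) (S.le_cl _)⟩
  le_sup_left x y := le_sup_left.trans (S.le_cl (x.1 ⊔ y.1))
  le_sup_right x y := le_sup_right.trans (S.le_cl (x.1 ⊔ y.1))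
  sup_le x y z h h' := (S.cl_mono (sup_le (show x.1 ≤ z.1 from h) h')).trans z.2.le
  inf_le_left x y := inf_le_left (a := x.1)
  inf_le_right x y := inf_le_right (a := x.1)
  le_inf x y z h h' := le_inf (show x.1 ≤ y.1 from h) h'

variable {S}

end LinkSystem

namespace LinkSystem

variable {Γ : Type w} {D : Γ → Type u} [∀ c, Lattice (D c)] {S : LinkSystem Γ D}

variable (S) in
/-- Tuples fixed by the closure: the proper elements of the linked sum. -/
structure Closed (s : ∀ c, WithBot (D c)) : Prop where
  support : ∀ a b c, s a ≠ ⊥ → s b ≠ ⊥ → s c ≠ ⊥ → a = b ∨ a = c ∨ b = c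
  linked : ∀ (a b : Γ) (x : D a) (y : D b), a ≠ b → s a = x → s b = y →
    S.link a b x y = some x

theorem Closed.good {s : ∀ c, WithBot (D c)} (hs : S.Closed s) : S.Good s :=
  ⟨hs.support, fun a b x y hne hx hy => by simp [hs.linked a b x y hne hx hy]⟩

theorem Closed.close_eq {s : ∀ c, WithBot (D c)} (hs : S.Closed s) : S.close s = s := by
  funext c
  rcases hc : s c with _ | x
  · exact close_eq_bot hc
  · rcases hs.good.close_cases hc with ⟨-, h'⟩ | ⟨c', y, z, hne, hy, hz, h'⟩
    · exact h'
    · rw [hs.linked c c' x y hne hc hy, Option.some_inj] at hz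
      rw [h', ← hz]
      rfl

theorem Good.closed_close {s : ∀ c, WithBot (D c)} (hs : S.Good s) : S.Closed (S.close s) :=
  ⟨hs.good_close.support, fun _ _ _ _ hne hx hy => hs.link_close hne hx hy⟩

namespace Sum

/-- The element of the linked sum given by a closed tuple. -/
noncomputable def tuple (s : ∀ c, WithBot (D c)) (hs : S.Closed s) : S.Sum :=
  ⟨s, by rw [S.cl_of_good hs.good, hs.close_eq]⟩

noncomputable instance : OrderTop S.Sum where
  top := ⟨⊤, rfl⟩
  le_top m := le_top (a := m.1)

theorem closed_bot : S.Closed ⊥ :=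
  ⟨fun _ _ _ h => absurd rfl h, fun _ _ _ _ _ h => by simp at h⟩

noncomputable instance : OrderBot S.Sum where
  bot := tuple ⊥ closed_bot
  bot_le m := show ((⊥ : ∀ c, WithBot (D c)) : WithTop (∀ c, WithBot (D c))) ≤ m.1 from
    WithTop.coe_bot.le.trans bot_le

theorem bot_def : (⊥ : S.Sum) = tuple ⊥ closed_bot := rfl

theorem tuple_ne_top {s : ∀ c, WithBot (D c)} {hs : S.Closed s} : tuple s hs ≠ ⊤ := fun h =>
  WithTop.coe_ne_top (congrArg Subtype.val h)

theorem tuple_le_tuple {s t : ∀ c, WithBot (D c)} {hs : S.Closed s} {ht : S.Closed t} :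
    tuple s hs ≤ tuple t ht ↔ s ≤ t := WithTop.coe_le_coe

theorem tuple_inj {s t : ∀ c, WithBot (D c)} {hs : S.Closed s} {ht : S.Closed t} :
    tuple s hs = tuple t ht ↔ s = t := by
  simp only [le_antisymm_iff, tuple_le_tuple]

theorem tuple_eq_bot {s : ∀ c, WithBot (D c)} {hs : S.Closed s} :
    tuple s hs = ⊥ ↔ ∀ c, s c = ⊥ := by
  rw [bot_def, tuple_inj, funext_iff]; rfl

theorem eq_top_or (m : S.Sum) : m = ⊤ ∨ ∃ s hs, m = tuple s hs := by
  obtain ⟨m, hm⟩ := m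
  induction m using WithTop.recTopCoe with
  | top => exact Or.inl rfl
  | coe s =>
    refine Or.inr ⟨s, ?_, rfl⟩
    by_cases hs : S.Good s
    · rw [S.cl_of_good hs, WithTop.coe_inj] at hm
      rw [← hm]
      exact hs.closed_close
    · rw [S.cl_of_not_good hs] at hm
      simp at hm

theorem tuple_sup_tuple {s t : ∀ c, WithBot (D c)} {hs : S.Closed s} {ht : S.Closed t}
    (h : S.Good (s ⊔ t)) : tuple s hs ⊔ tuple t ht = tuple (S.close (s ⊔ t)) h.closed_close :=
  Subtype.ext (S.cl_of_good h)

theorem tuple_sup_tuple_of_not_good {s t : ∀ c, WithBot (D c)} {hs : S.Closed s} {ht : S.Closed t}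
    (h : ¬ S.Good (s ⊔ t)) : tuple s hs ⊔ tuple t ht = ⊤ :=
  Subtype.ext (S.cl_of_not_good h)

theorem closed_inf {s t : ∀ c, WithBot (D c)} (hs : S.Closed s) (ht : S.Closed t) :
    S.Closed (s ⊓ t) := by
  have : S.cl ((s ⊓ t : ∀ c, WithBot (D c)) : WithTop (∀ c, WithBot (D c))) = (s ⊓ t : _) :=
    (tuple s hs ⊓ tuple t ht).2
  rcases eq_top_or (S := S) ⟨_, this⟩ with h | ⟨r, hr, h⟩
  · exact absurd (congrArg Subtype.val h) WithTop.coe_ne_top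
  · rwa [WithTop.coe_inj.1 (congrArg Subtype.val h)]

theorem tuple_inf_tuple {s t : ∀ c, WithBot (D c)} {hs : S.Closed s} {ht : S.Closed t} :
    tuple s hs ⊓ tuple t ht = tuple (s ⊓ t) (closed_inf hs ht) := rfl

open Classical in
theorem closed_update_bot (c : Γ) (x : D c) : S.Closed (Function.update ⊥ c (x : WithBot (D c))) := by
  have h : ∀ a, Function.update (⊥ : ∀ c, WithBot (D c)) c (x : WithBot (D c)) a ≠ ⊥ → a = c := by
    intro a ha
    by_contra hne
    exact ha (by rw [Function.update_of_ne hne]; rfl)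
  refine ⟨fun a b _ ha hb _ => Or.inl ((h a ha).trans (h b hb).symm), ?_⟩
  intro a b y z hne hy hz
  exact absurd ((h a (by simp [hy])).trans (h b (by simp [hz])).symm) hne

open Classical in
/-- The element of the linked sum concentrated at one component. -/
noncomputable def base (c : Γ) (x : D c) : S.Sum :=
  tuple (Function.update ⊥ c (x : WithBot (D c))) (closed_update_bot c x)

theorem base_ne_top {c : Γ} {x : D c} : (base c x : S.Sum) ≠ ⊤ := tuple_ne_top

theorem base_le_tuple {c : Γ} {x : D c} {s : ∀ c, WithBot (D c)} {hs : S.Closed s} :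
    base c x ≤ tuple s hs ↔ (x : WithBot (D c)) ≤ s c := by
  classical
  rw [base, tuple_le_tuple, update_le_iff]
  exact ⟨fun h => h.1, fun h => ⟨h, fun _ _ => bot_le⟩⟩

theorem base_le_base {c : Γ} {x y : D c} : (base c x : S.Sum) ≤ base c y ↔ x ≤ y := by
  rw [base.eq_1 c y, base_le_tuple]
  simp

theorem not_base_le_base {c d : Γ} {x : D c} {y : D d} (h : c ≠ d) :
    ¬ (base c x : S.Sum) ≤ base d y := by
  classical
  rw [base.eq_1 d y, base_le_tuple, Function.update_of_ne h]
  simp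

theorem base_inj {c : Γ} {x y : D c} : (base c x : S.Sum) = base c y ↔ x = y := by
  simp only [le_antisymm_iff, base_le_base]

theorem base_lt_base {c : Γ} {x y : D c} : (base c x : S.Sum) < base c y ↔ x < y := by
  simp only [lt_iff_le_not_ge, base_le_base]

theorem base_ne_bot {c : Γ} {x : D c} : (base c x : S.Sum) ≠ ⊥ := by
  intro h
  have := tuple_eq_bot.1 h c
  simp at this

theorem eq_bot_or_base_of_support {s : ∀ c, WithBot (D c)} {hs : S.Closed s} {c : Γ}
    (h : ∀ d, d ≠ c → s d = ⊥) : tuple s hs = ⊥ ∨ ∃ x : D c, s c = x ∧ tuple s hs = base c x := by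
  classical
  rcases hc : s c with _ | x
  · refine Or.inl (tuple_eq_bot.2 fun d => ?_)
    by_cases hd : d = c
    · subst hd; exact hc
    · exact h d hd
  · refine Or.inr ⟨x, rfl, ?_⟩
    rw [base, tuple_inj]
    funext d
    by_cases hd : d = c
    · subst hd; rw [Function.update_self]; exact hc
    · rw [Function.update_of_ne hd]; exact h d hd

theorem le_base_iff {m : S.Sum} {c : Γ} {x : D c} :
    m ≤ base c x ↔ m = ⊥ ∨ ∃ y ≤ x, m = base c y := by
  classical
  constructor
  · intro h
    rcases eq_top_or m with rfl | ⟨s, hs, rfl⟩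
    · exact absurd (top_le_iff.1 h) base_ne_top
    · have h' := h
      rw [base, tuple_le_tuple, le_update_iff] at h'
      rcases eq_bot_or_base_of_support (hs := hs) (c := c) fun d hd => le_bot_iff.1 (h'.2 d hd)
        with h1 | ⟨y, -, h1⟩
      · exact Or.inl h1
      · rw [h1, base_le_base] at h
        exact Or.inr ⟨y, h, h1⟩
  · rintro (rfl | ⟨y, hy, rfl⟩)
    · exact bot_le
    · exact base_le_base.2 hy

theorem base_inf_base (c : Γ) (x y : D c) : (base c x : S.Sum) ⊓ base c y = base c (x ⊓ y) := by
  apply le_antisymm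
  · rcases le_base_iff.1 (inf_le_left : (base c x : S.Sum) ⊓ base c y ≤ base c x) with h | ⟨z, -, h⟩
    · rw [h]; exact bot_le
    · have h1 := inf_le_left (a := (base c x : S.Sum)) (b := base c y)
      have h2 := inf_le_right (a := (base c x : S.Sum)) (b := base c y)
      rw [h, base_le_base] at *
      exact le_inf h1 h2
  · exact le_inf (base_le_base.2 inf_le_left) (base_le_base.2 inf_le_right)

theorem base_sup_base (c : Γ) (x y : D c) : (base c x : S.Sum) ⊔ base c y = base c (x ⊔ y) := by
  apply le_antisymm
  · exact sup_le (base_le_base.2 le_sup_left) (base_le_base.2 le_sup_right)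
  · have h := sup_le (base_le_base (S := S).2 (le_sup_left : x ≤ x ⊔ y)) (base_le_base.2 le_sup_right)
    rcases le_base_iff.1 h with h' | ⟨z, -, h'⟩
    · exact absurd (le_bot_iff.1 (h' ▸ (le_sup_left : base c x ≤ base c x ⊔ base c y))) base_ne_bot
    · have h1 := le_sup_left (a := (base c x : S.Sum)) (b := base c y)
      have h2 := le_sup_right (a := (base c x : S.Sum)) (b := base c y)
      rw [h', base_le_base] at *
      exact sup_le h1 h2

theorem inf_base_eq_bot {m : S.Sum} {c : Γ} (h : ∀ y, ¬ base c y ≤ m) (x : D c) :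
    m ⊓ base c x = ⊥ := by
  rcases le_base_iff.1 (inf_le_right : m ⊓ base c x ≤ base c x) with h' | ⟨y, -, h'⟩
  · exact h'
  · exact absurd (h' ▸ inf_le_left) (h y)

theorem base_inf_base_of_ne {c d : Γ} (h : c ≠ d) (x : D c) (y : D d) :
    (base c x : S.Sum) ⊓ base d y = ⊥ :=
  inf_base_eq_bot (fun _ => not_base_le_base h.symm) y

theorem closed_link {m : S.Sum} (hm : m ≠ ⊤) {c d : Γ} {x : D c} {y : D d}
    (hne : c ≠ d) (hx : base c x ≤ m) (hy : base d y ≤ m) :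
    ∃ z, S.link c d x y = some z ∧ base c z ≤ m := by
  rcases eq_top_or m with rfl | ⟨s, hs, rfl⟩
  · exact absurd rfl hm
  · rw [base_le_tuple] at hx hy
    obtain ⟨x', hx1, hx2⟩ := WithBot.coe_le_iff.1 hx
    obtain ⟨y', hy1, hy2⟩ := WithBot.coe_le_iff.1 hy
    obtain ⟨z, hz, hz'⟩ := S.link_mono hx2 hy2 (hs.linked c d x' y' hne hx1 hy1)
    exact ⟨z, hz, by rwa [base_le_tuple, hx1, WithBot.coe_le_coe]⟩

theorem base_sup_eq_top {c d : Γ} {x : D c} {y : D d} (hne : c ≠ d) (h : S.link c d x y = none) :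
    (base c x : S.Sum) ⊔ base d y = ⊤ := by
  by_contra hm
  obtain ⟨z, hz, -⟩ := closed_link hm hne le_sup_left le_sup_right
  simp [h] at hz

open Classical in
theorem closed_update_update {c d : Γ} {x : D c} {y : D d} (hne : c ≠ d)
    (hx : S.link c d x y = some x) (hy : S.link d c y x = some y) :
    S.Closed (Function.update (Function.update ⊥ c (x : WithBot (D c))) d (y : WithBot (D d))) := by
  set s := Function.update (Function.update (⊥ : ∀ c, WithBot (D c)) c (x : WithBot (D c))) d
    (y : WithBot (D d)) with hs
  have hc : s c = x := by rw [hs, Function.update_of_ne hne, Function.update_self]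
  have hd : s d = y := by rw [hs, Function.update_self]
  have h : ∀ a, s a ≠ ⊥ → a = c ∨ a = d := by
    intro a ha
    by_contra! hne
    exact ha (by rw [hs, Function.update_of_ne hne.2, Function.update_of_ne hne.1]; rfl)
  refine ⟨?_, ?_⟩
  · intro a b c ha hb hc
    rcases h a ha with rfl | rfl <;> rcases h b hb with rfl | rfl <;> rcases h _ hc with rfl | rfl <;>
      simp
  · intro a b u v hab hu hv
    rcases h a (by simp [hu]) with rfl | rfl <;> rcases h b (by simp [hv]) with rfl | rfl
    · exact absurd rfl hab
    · rw [hc, WithBot.coe_inj] at hu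
      rw [hd, WithBot.coe_inj] at hv
      subst hu hv; exact hx
    · rw [hd, WithBot.coe_inj] at hu
      rw [hc, WithBot.coe_inj] at hv
      subst hu hv; exact hy
    · exact absurd rfl hab

theorem base_sup_base_of_link {c d : Γ} {x z : D c} {y w : D d} (hne : c ≠ d)
    (hz : S.link c d x y = some z) (hw : S.link d c y x = some w) :
    (base c x : S.Sum) ⊔ base d y ≠ ⊤ ∧
    (∀ u, (base c u : S.Sum) ≤ base c x ⊔ base d y ↔ u ≤ z) ∧
    (∀ u, (base d u : S.Sum) ≤ base c x ⊔ base d y ↔ u ≤ w) := by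
  classical
  have hcl := closed_update_update hne (S.link_link hz hw) (S.link_link hw hz)
  set s := Function.update (Function.update (⊥ : ∀ c, WithBot (D c)) c (z : WithBot (D c))) d
    (w : WithBot (D d)) with hs
  have hc : s c = z := by rw [hs, Function.update_of_ne hne, Function.update_self]
  have hd : s d = w := by rw [hs, Function.update_self]
  have hle : (base c x : S.Sum) ⊔ base d y ≤ tuple s hcl := sup_le
    (by rw [base_le_tuple, hc, WithBot.coe_le_coe]; exact S.le_link hz)
    (by rw [base_le_tuple, hd, WithBot.coe_le_coe]; exact S.le_link hw)
  have hnt : (base c x : S.Sum) ⊔ base d y ≠ ⊤ := fun h => tuple_ne_top (top_le_iff.1 (h ▸ hle))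
  refine ⟨hnt, fun u => ⟨fun h => ?_, fun h => ?_⟩, fun u => ⟨fun h => ?_, fun h => ?_⟩⟩
  · have := h.trans hle
    rwa [base_le_tuple, hc, WithBot.coe_le_coe] at this
  · obtain ⟨z', hz', h'⟩ := closed_link hnt hne le_sup_left le_sup_right
    rw [hz, Option.some_inj] at hz'
    subst hz'
    exact (base_le_base.2 h).trans h'
  · have := h.trans hle
    rwa [base_le_tuple, hd, WithBot.coe_le_coe] at this
  · obtain ⟨z', hz', h'⟩ := closed_link hnt hne.symm le_sup_right le_sup_left
    rw [hw, Option.some_inj] at hz'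
    subst hz'
    exact (base_le_base.2 h).trans h'

theorem exists_link_symm {c d : Γ} {x z : D c} {y : D d} (hz : S.link c d x y = some z) :
    ∃ w, S.link d c y x = some w := by
  rw [← Option.ne_none_iff_exists']
  intro h
  simp [S.link_symm h] at hz

/-- The trace of a join on a principal ideal of a component. -/
theorem base_sup_base_inf_base {c d : Γ} {x z u : D c} {y : D d} (hne : c ≠ d)
    (hz : S.link c d x y = some z) (hu : z ≤ u) :
    ((base c x : S.Sum) ⊔ base d y) ⊓ base c u = base c z := by
  obtain ⟨w, hw⟩ := exists_link_symm hz
  obtain ⟨-, h, -⟩ := base_sup_base_of_link hne hz hw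
  apply le_antisymm
  · rcases le_base_iff.1 (inf_le_right : ((base c x : S.Sum) ⊔ base d y) ⊓ base c u ≤ base c u)
      with h' | ⟨v, hv, h'⟩
    · rw [h']; exact bot_le
    · rw [h', base_le_base, ← h v, ← h']
      exact inf_le_left
  · exact le_inf ((h z).2 le_rfl) (base_le_base.2 hu)

/-- A proper element with two support points is the join of its components. -/
theorem tuple_eq_sup {s : ∀ c, WithBot (D c)} {hs : S.Closed s} {c d : Γ} {x : D c} {y : D d}
    (hne : c ≠ d) (hx : s c = x) (hy : s d = y) : tuple s hs = base c x ⊔ base d y := by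
  apply le_antisymm
  · have hsup : (base c x : S.Sum) ⊔ base d y ≤ tuple s hs :=
      sup_le (by rw [base_le_tuple, hx]) (by rw [base_le_tuple, hy])
    rcases eq_top_or ((base c x : S.Sum) ⊔ base d y) with h | ⟨t, ht, h⟩
    · rw [h]; exact le_top
    · have h1 := le_sup_left (a := (base c x : S.Sum)) (b := base d y)
      have h2 := le_sup_right (a := (base c x : S.Sum)) (b := base d y)
      rw [h] at h1 h2 ⊢
      rw [base_le_tuple] at h1 h2
      rw [tuple_le_tuple]
      intro e
      by_cases hc : e = c
      · subst hc; exact hx.le.trans h1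
      by_cases hd : e = d
      · subst hd; exact hy.le.trans h2
      by_cases he : s e = ⊥
      · rw [he]; exact bot_le
      rcases hs.support e c d he (by simp [hx]) (by simp [hy]) with h | h | h
      exacts [absurd h hc, absurd h hd, absurd h hne]
  · exact sup_le (by rw [base_le_tuple, hx]) (by rw [base_le_tuple, hy])

theorem tuple_cases (s : ∀ c, WithBot (D c)) (hs : S.Closed s) :
    tuple s hs = ⊥ ∨ (∃ (c : Γ) (x : D c), s c = x ∧ (∀ d, d ≠ c → s d = ⊥) ∧ tuple s hs = base c x) ∨
    ∃ (c d : Γ) (x : D c) (y : D d), c ≠ d ∧ s c = x ∧ s d = y ∧ tuple s hs = base c x ⊔ base d y := by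
  by_cases h : ∀ c, s c = ⊥
  · exact Or.inl (tuple_eq_bot.2 h)
  push Not at h
  obtain ⟨c, hc⟩ := h
  obtain ⟨x, hx⟩ := WithBot.ne_bot_iff_exists.1 hc
  by_cases h : ∀ d, d ≠ c → s d = ⊥
  · rcases eq_bot_or_base_of_support (hs := hs) h with h' | ⟨x, hx, h'⟩
    · exact Or.inl h'
    · exact Or.inr (Or.inl ⟨c, x, hx, h, h'⟩)
  push Not at h
  obtain ⟨d, hne, hd⟩ := h
  obtain ⟨y, hy⟩ := WithBot.ne_bot_iff_exists.1 hd
  exact Or.inr (Or.inr ⟨c, d, x, y, hne.symm, hx.symm, hy.symm,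
    tuple_eq_sup hne.symm hx.symm hy.symm⟩)

theorem base_covBy_base {c : Γ} {x y : D c} (h : x ⋖ y) : (base c x : S.Sum) ⋖ base c y := by
  refine ⟨base_lt_base.2 h.1, fun m h1 h2 => ?_⟩
  rcases le_base_iff.1 h2.le with rfl | ⟨z, -, rfl⟩
  · exact base_ne_bot (le_bot_iff.1 h1.le)
  · exact h.2 (base_lt_base.1 h1) (base_lt_base.1 h2)

end Sum

end LinkSystem

/-! ### Congruences -/

namespace IsLatCon

variable {L : Type*} [Lattice L] {r : L → L → Prop}

theorem refl (h : IsLatCon r) (a : L) : r a a := h.1.refl a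

theorem symm (h : IsLatCon r) {a b : L} (hab : r a b) : r b a := h.1.symm hab

theorem trans (h : IsLatCon r) {a b c : L} (hab : r a b) (hbc : r b c) : r a c := h.1.trans hab hbc

theorem inf (h : IsLatCon r) {a b c d : L} (hab : r a b) (hcd : r c d) : r (a ⊓ c) (b ⊓ d) :=
  h.2.1 a b c d hab hcd

theorem sup (h : IsLatCon r) {a b c d : L} (hab : r a b) (hcd : r c d) : r (a ⊔ c) (b ⊔ d) :=
  h.2.2 a b c d hab hcd

theorem comap {M : Type*} [Lattice M] (h : IsLatCon r) (f : M → L)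
    (hinf : ∀ x y, f (x ⊓ y) = f x ⊓ f y) (hsup : ∀ x y, f (x ⊔ y) = f x ⊔ f y) :
    IsLatCon fun x y => r (f x) (f y) :=
  ⟨⟨fun a => h.refl _, fun h' => h.symm h', fun h1 h2 => h.trans h1 h2⟩,
    fun a b c d h1 h2 => by simp only [hinf]; exact h.inf h1 h2,
    fun a b c d h1 h2 => by simp only [hsup]; exact h.sup h1 h2⟩

theorem eq : IsLatCon (fun x y : L => x = y) :=
  ⟨⟨fun _ => rfl, Eq.symm, Eq.trans⟩, fun _ _ _ _ h h' => by rw [h, h'],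
    fun _ _ _ _ h h' => by rw [h, h']⟩

theorem all : IsLatCon (fun _ _ : L => True) :=
  ⟨⟨fun _ => trivial, fun _ => trivial, fun _ _ => trivial⟩, fun _ _ _ _ _ _ => trivial,
    fun _ _ _ _ _ _ => trivial⟩

end IsLatCon

theorem cg_isLatCon {L : Type*} [Lattice L] (a b : L) : IsLatCon (cg a b) :=
  ⟨⟨fun _ _ hr _ => hr.refl _, fun h r hr hab => hr.symm (h r hr hab),
    fun h h' r hr hab => hr.trans (h r hr hab) (h' r hr hab)⟩,
    fun _ _ _ _ h h' r hr hab => hr.inf (h r hr hab) (h' r hr hab),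
    fun _ _ _ _ h h' r hr hab => hr.sup (h r hr hab) (h' r hr hab)⟩

theorem cg_self {L : Type*} [Lattice L] (a b : L) : cg a b a b := fun _ _ h => h

namespace LinkSystem

variable {Γ : Type w} {D : Γ → Type u} [∀ c, Lattice (D c)] {S : LinkSystem Γ D}

open LinkSystem.Sum

section Transfer

variable {r : S.Sum → S.Sum → Prop}

theorem con_transfer (hr : IsLatCon r) {c d : Γ} {x z z' : D c} {y y' : D d} (hne : c ≠ d)
    (hz : S.link c d x y = some z) (hz' : S.link c d x y' = some z')
    (h : r (base d y) (base d y')) : r (base c z) (base c z') := by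
  have := hr.inf (hr.sup (hr.refl (base c x)) h) (hr.refl (base c (z ⊔ z')))
  rwa [base_sup_base_inf_base hne hz le_sup_left, base_sup_base_inf_base hne hz' le_sup_right]
    at this

theorem con_transfer_top (hr : IsLatCon r) {c d : Γ} {x : D c} {y y' : D d} (hne : c ≠ d)
    (hz : S.link c d x y' = none) (h : r (base d y) (base d y')) :
    r (base c x ⊔ base d y) ⊤ := by
  have := hr.sup (hr.refl (base c x)) h
  rwa [base_sup_eq_top hne hz] at this

end Transfer

variable (S) in
/-- Three one-element components that are linked with no other component. -/
structure Points where
  idx : Fin 3 → Γ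
  idx_inj : Function.Injective idx
  pt : ∀ j, D (idx j)
  eq_pt : ∀ j (y : D (idx j)), y = pt j
  link_eq : ∀ j (c : Γ) (y : D c), c ≠ idx j → S.link (idx j) c (pt j) y = none

namespace Points

variable (P : S.Points)

/-- The doubly irreducible elements given by the isolated components. -/
noncomputable def elt (j : Fin 3) : S.Sum := base (P.idx j) (P.pt j)

theorem elt_inj : Function.Injective P.elt := by
  intro i j h
  by_contra hne
  exact not_base_le_base (fun h' => hne (P.idx_inj h')) h.le

theorem elt_le {j : Fin 3} {m : S.Sum} (h : P.elt j ≤ m) : m = ⊤ ∨ m = P.elt j := by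
  by_cases hm : m = ⊤
  · exact Or.inl hm
  refine Or.inr ?_
  have hd : ∀ (d : Γ) (y : D d), d ≠ P.idx j → ¬ base d y ≤ m := by
    intro d y hne hy
    obtain ⟨z, hz, -⟩ := closed_link hm hne.symm h hy
    simp [P.link_eq j d y hne] at hz
  rcases eq_top_or m with h' | ⟨s, hs, rfl⟩
  · exact absurd h' hm
  rcases eq_bot_or_base_of_support (hs := hs) (c := P.idx j) (fun d hd' => by
    by_contra hne
    obtain ⟨y, hy⟩ := WithBot.ne_bot_iff_exists.1 hne
    exact hd d y hd' (by rw [base_le_tuple, hy])) with h' | ⟨x, -, h'⟩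
  · rw [h', elt] at h
    exact absurd (le_bot_iff.1 h) base_ne_bot
  · rw [h', P.eq_pt j x]; rfl

theorem le_elt {j : Fin 3} {m : S.Sum} (h : m ≤ P.elt j) : m = ⊥ ∨ m = P.elt j := by
  rcases le_base_iff.1 h with h | ⟨y, -, h⟩
  · exact Or.inl h
  · exact Or.inr (by rw [h, P.eq_pt j y]; rfl)

theorem bot_covBy (j : Fin 3) : ⊥ ⋖ P.elt j := by
  refine ⟨bot_lt_iff_ne_bot.2 base_ne_bot, fun m h h' => ?_⟩
  rcases P.le_elt h'.le with rfl | rfl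
  exacts [h.ne rfl, h'.ne rfl]

theorem covBy_top (j : Fin 3) : P.elt j ⋖ ⊤ := by
  refine ⟨lt_top_iff_ne_top.2 base_ne_top, fun m h h' => ?_⟩
  rcases P.elt_le h.le with rfl | rfl
  exacts [h'.ne rfl, h.ne rfl]

theorem inf_elt {j : Fin 3} {m : S.Sum} (ht : m ≠ ⊤) (hne : m ≠ P.elt j) : m ⊓ P.elt j = ⊥ := by
  rcases P.le_elt (inf_le_right : m ⊓ P.elt j ≤ P.elt j) with h | h
  · exact h
  · rcases P.elt_le (inf_eq_right.1 h) with h | h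
    exacts [absurd h ht, absurd h hne]

theorem sup_elt {j : Fin 3} {m : S.Sum} (hb : m ≠ ⊥) (hne : m ≠ P.elt j) : m ⊔ P.elt j = ⊤ := by
  rcases P.elt_le (le_sup_right : P.elt j ≤ m ⊔ P.elt j) with h | h
  · exact h
  · rcases P.le_elt (sup_eq_right.1 h) with h | h
    exacts [absurd h hb, absurd h hne]

theorem exists_ne_ne (m : S.Sum) : ∃ i j, i ≠ j ∧ m ≠ P.elt i ∧ m ≠ P.elt j := by
  have h01 := P.elt_inj.ne (show (0 : Fin 3) ≠ 1 by decide)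
  have h02 := P.elt_inj.ne (show (0 : Fin 3) ≠ 2 by decide)
  have h12 := P.elt_inj.ne (show (1 : Fin 3) ≠ 2 by decide)
  by_cases h0 : m = P.elt 0
  · exact ⟨1, 2, by decide, h0 ▸ h01, h0 ▸ h02⟩
  by_cases h1 : m = P.elt 1
  · exact ⟨0, 2, by decide, h0, h1 ▸ h12⟩
  · exact ⟨0, 1, by decide, h0, h1⟩

variable {r : S.Sum → S.Sum → Prop}

theorem full_of_bot (P : S.Points) (hr : IsLatCon r) {m : S.Sum} (hm : m ≠ ⊥) (h : r ⊥ m) : r ⊥ ⊤ := by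
  obtain ⟨i, j, hij, hi, hj⟩ := P.exists_ne_ne m
  have h1 := hr.sup h (hr.refl (P.elt i))
  have h2 := hr.sup h (hr.refl (P.elt j))
  rw [bot_sup_eq, P.sup_elt hm hi] at h1
  rw [bot_sup_eq, P.sup_elt hm hj] at h2
  have h3 := hr.inf h1 h2
  rwa [P.inf_elt (m := P.elt i) base_ne_top (P.elt_inj.ne hij), inf_idem] at h3

theorem full_of_inf_eq_bot (P : S.Points) (hr : IsLatCon r) {s t m : S.Sum} (h : r s t) (hm : m ≠ ⊥)
    (hmt : m ≤ t) (hms : s ⊓ m = ⊥) : r ⊥ ⊤ := by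
  have := hr.inf h (hr.refl m)
  rw [hms, inf_eq_right.2 hmt] at this
  exact P.full_of_bot hr hm this

theorem full_of_top (P : S.Points) (hr : IsLatCon r) {s : S.Sum} (hs : s ≠ ⊤) (h : r s ⊤) : r ⊥ ⊤ := by
  obtain ⟨i, -, -, hi, -⟩ := P.exists_ne_ne s
  exact P.full_of_inf_eq_bot hr h base_ne_bot le_top (P.inf_elt hs hi)

end Points

theorem con_full {r : S.Sum → S.Sum → Prop} (hr : IsLatCon r) (h : r ⊥ ⊤)
    (x y : S.Sum) : r x y := by
  have h' : ∀ x, r ⊥ x := fun x => by simpa using hr.inf h (hr.refl x)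
  exact hr.trans (hr.symm (h' x)) (h' y)

theorem pair_cases (P : S.Points) {s t : S.Sum} (hst : s ≤ t) :
    s = t ∨ (∀ r, IsLatCon r → r s t → r ⊥ ⊤) ∨
    (∃ (c : Γ) (x x' : D c), x ≤ x' ∧ s = base c x ∧ t = base c x') ∨
    ∃ (c d : Γ) (x x' : D c) (y y' : D d), c ≠ d ∧ x ≤ x' ∧ y ≤ y' ∧
      S.link c d x y = some x ∧ S.link d c y x = some y ∧
      S.link c d x' y' = some x' ∧ S.link d c y' x' = some y' ∧
      s = base c x ⊔ base d y ∧ t = base c x' ⊔ base d y' := by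
  by_cases hne : s = t
  · exact Or.inl hne
  refine Or.inr ?_
  rcases eq_top_or t with rfl | ⟨τ, hτ, rfl⟩
  · exact Or.inl fun r hr h => P.full_of_top hr hne h
  rcases eq_top_or s with rfl | ⟨σ, hσ, rfl⟩
  · exact absurd (top_le_iff.1 hst) tuple_ne_top
  by_cases hsup : ∃ c, σ c = ⊥ ∧ τ c ≠ ⊥
  · obtain ⟨c, hc, hc'⟩ := hsup
    obtain ⟨x, hx⟩ := WithBot.ne_bot_iff_exists.1 hc'
    refine Or.inl fun r hr h => P.full_of_inf_eq_bot hr h (m := base c x) base_ne_bot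
      (by rw [base_le_tuple, hx]) (inf_base_eq_bot (fun y => ?_) x)
    rw [base_le_tuple, hc]
    simp
  push Not at hsup
  rw [tuple_le_tuple] at hst
  rcases tuple_cases τ hτ with h | ⟨c, x', hx', hbot, h⟩ | ⟨c, d, x', y', hcd, hx', hy', h⟩
  · rw [h, tuple_eq_bot] at hne
    exact absurd (fun c => le_bot_iff.1 ((hst c).trans (tuple_eq_bot.1 h c).le)) hne
  · obtain ⟨x, hx⟩ := WithBot.ne_bot_iff_exists.1 (fun hc => by simpa [hx'] using hsup c hc)
    refine Or.inr (Or.inl ⟨c, x, x', ?_, ?_, h⟩)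
    · have := hst c
      rwa [← hx, hx', WithBot.coe_le_coe] at this
    · rcases eq_bot_or_base_of_support (hs := hσ) (c := c) (fun d hd =>
        le_bot_iff.1 ((hst d).trans (hbot d hd).le)) with h' | ⟨x₁, hx₁, h'⟩
      · have := tuple_eq_bot.1 h' c
        simp [← hx] at this
      · rw [← hx, WithBot.coe_inj] at hx₁
        rw [h', hx₁]
  · obtain ⟨x, hx⟩ := WithBot.ne_bot_iff_exists.1 (fun hc => by simpa [hx'] using hsup c hc)
    obtain ⟨y, hy⟩ := WithBot.ne_bot_iff_exists.1 (fun hc => by simpa [hy'] using hsup d hc)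
    have h1 := hst c
    have h2 := hst d
    rw [← hx, hx', WithBot.coe_le_coe] at h1
    rw [← hy, hy', WithBot.coe_le_coe] at h2
    exact Or.inr (Or.inr ⟨c, d, x, x', y, y', hcd, h1, h2, hσ.linked _ _ _ _ hcd hx.symm hy.symm,
      hσ.linked _ _ _ _ hcd.symm hy.symm hx.symm, hτ.linked _ _ _ _ hcd hx' hy',
      hτ.linked _ _ _ _ hcd.symm hy' hx', tuple_eq_sup hcd hx.symm hy.symm, h⟩)

theorem con_pair_iff {r : S.Sum → S.Sum → Prop} (hr : IsLatCon r) {c d : Γ} {x x' : D c}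
    {y y' : D d} (hne : c ≠ d) (hxx : x ≤ x') (hyy : y ≤ y')
    (hx : S.link c d x y = some x) (hy : S.link d c y x = some y)
    (hx' : S.link c d x' y' = some x') (hy' : S.link d c y' x' = some y') :
    r (base c x ⊔ base d y) (base c x' ⊔ base d y') ↔
      r (base c x) (base c x') ∧ r (base d y) (base d y') := by
  refine ⟨fun h => ⟨?_, ?_⟩, fun h => hr.sup h.1 h.2⟩
  · have := hr.inf h (hr.refl (base c x'))
    rwa [base_sup_base_inf_base hne hx hxx, base_sup_base_inf_base hne hx' le_rfl] at this
  · have := hr.inf h (hr.refl (base d y'))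
    rwa [sup_comm, base_sup_base_inf_base hne.symm hy hyy, sup_comm,
      base_sup_base_inf_base hne.symm hy' le_rfl] at this

/-! ### Congruences glued from the components -/

/-- The extension of a relation to `WithBot` in which `⊥` forms a class of its own. -/
def botRel {α : Type*} (r : α → α → Prop) (x y : WithBot α) : Prop :=
  (x = ⊥ ∧ y = ⊥) ∨ ∃ a b : α, x = a ∧ y = b ∧ r a b

section botRel

variable {α : Type*} {r : α → α → Prop}

theorem botRel_coe {a b : α} : botRel r (a : WithBot α) b ↔ r a b := by
  simp [botRel]

theorem botRel_coe_left {a : α} {y : WithBot α} : botRel r a y ↔ ∃ b : α, y = b ∧ r a b := by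
  simp [botRel]

theorem botRel_bot_left {y : WithBot α} : botRel r ⊥ y ↔ y = ⊥ := by
  simp [botRel]

variable [Lattice α]

theorem botRel_refl (h : IsLatCon r) (x : WithBot α) : botRel r x x := by
  induction x using WithBot.recBotCoe with
  | bot => exact Or.inl ⟨rfl, rfl⟩
  | coe a => exact botRel_coe.2 (h.refl a)

theorem botRel_symm (h : IsLatCon r) {x y : WithBot α} (hxy : botRel r x y) : botRel r y x := by
  rcases hxy with ⟨rfl, rfl⟩ | ⟨a, b, rfl, rfl, hab⟩
  · exact Or.inl ⟨rfl, rfl⟩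
  · exact botRel_coe.2 (h.symm hab)

theorem botRel_trans (h : IsLatCon r) {x y z : WithBot α} (hxy : botRel r x y)
    (hyz : botRel r y z) : botRel r x z := by
  rcases hxy with ⟨rfl, rfl⟩ | ⟨a, b, rfl, rfl, hab⟩
  · exact hyz
  · obtain ⟨c, rfl, hbc⟩ := botRel_coe_left.1 hyz
    exact botRel_coe.2 (h.trans hab hbc)

theorem botRel_inf (h : IsLatCon r) {x y z t : WithBot α} (hxy : botRel r x y)
    (hzt : botRel r z t) : botRel r (x ⊓ z) (y ⊓ t) := by
  rcases hxy with ⟨rfl, rfl⟩ | ⟨a, b, rfl, rfl, hab⟩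
  · simp [botRel]
  · rcases hzt with ⟨rfl, rfl⟩ | ⟨c, d, rfl, rfl, hcd⟩
    · simp [botRel]
    · rw [← WithBot.coe_inf, ← WithBot.coe_inf]
      exact botRel_coe.2 (h.inf hab hcd)

theorem botRel_sup (h : IsLatCon r) {x y z t : WithBot α} (hxy : botRel r x y)
    (hzt : botRel r z t) : botRel r (x ⊔ z) (y ⊔ t) := by
  rcases hxy with ⟨rfl, rfl⟩ | ⟨a, b, rfl, rfl, hab⟩
  · simpa using hzt
  · rcases hzt with ⟨rfl, rfl⟩ | ⟨c, d, rfl, rfl, hcd⟩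
    · simpa using botRel_coe.2 hab
    · rw [← WithBot.coe_sup, ← WithBot.coe_sup]
      exact botRel_coe.2 (h.sup hab hcd)

end botRel

variable (S) in
/-- A family of congruences of the components that is compatible with the links. -/
structure LinkCon (θ : ∀ c, D c → D c → Prop) : Prop where
  con : ∀ c, IsLatCon (θ c)
  compat : ∀ {c d : Γ} {x x' z : D c} {y y' : D d}, S.link c d x y = some z → θ c x x' →
    θ d y y' → ∃ z', S.link c d x' y' = some z' ∧ θ c z z'

/-- The relation on the linked sum glued from relations on the components. -/
def glue (θ : ∀ c, D c → D c → Prop) (m n : S.Sum) : Prop :=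
  (m = ⊤ ∧ n = ⊤) ∨ ∃ s t hs ht, m = tuple s hs ∧ n = tuple t ht ∧ ∀ c, botRel (θ c) (s c) (t c)

section glue

variable {θ : ∀ c, D c → D c → Prop}

theorem glue_tuple {s t : ∀ c, WithBot (D c)} {hs : S.Closed s} {ht : S.Closed t} :
    glue θ (tuple s hs) (tuple t ht) ↔ ∀ c, botRel (θ c) (s c) (t c) := by
  constructor
  · rintro (⟨h, -⟩ | ⟨s', t', hs', ht', h1, h2, h⟩)
    · exact absurd h tuple_ne_top
    · rw [tuple_inj] at h1 h2
      subst h1 h2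
      exact h
  · exact fun h => Or.inr ⟨s, t, hs, ht, rfl, rfl, h⟩

theorem glue_base {c : Γ} {x y : D c} :
    glue (S := S) θ (base c x) (base c y) ↔ θ c x y := by
  classical
  rw [base, base, glue_tuple]
  constructor
  · intro h
    simpa [botRel] using h c
  · intro h d
    by_cases hd : d = c
    · subst hd
      simpa [botRel] using h
    · rw [Function.update_of_ne hd, Function.update_of_ne hd]
      exact Or.inl ⟨rfl, rfl⟩

theorem not_glue_bot_top : ¬ glue (S := S) θ ⊥ ⊤ := by
  rw [bot_def]
  rintro (⟨h, -⟩ | ⟨s', t', hs', ht', -, h, -⟩)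
  · exact tuple_ne_top h
  · exact tuple_ne_top h.symm

theorem Good.of_botRel (hθ : S.LinkCon θ) {s t : ∀ c, WithBot (D c)} (hs : S.Good s)
    (h : ∀ c, botRel (θ c) (s c) (t c)) :
    S.Good t ∧ ∀ c, botRel (θ c) (S.close s c) (S.close t c) := by
  have hb : ∀ c, t c ≠ ⊥ → s c ≠ ⊥ := by
    intro c hc hc'
    have := h c
    rw [hc', botRel_bot_left] at this
    exact hc this
  have hgood : S.Good t := by
    refine ⟨fun a b c ha hb' hc => hs.support a b c (hb a ha) (hb b hb') (hb c hc), ?_⟩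
    intro a b x y hne hx hy
    obtain ⟨x', hx'⟩ := WithBot.ne_bot_iff_exists.1 (hb a (by simp [hx]))
    obtain ⟨y', hy'⟩ := WithBot.ne_bot_iff_exists.1 (hb b (by simp [hy]))
    have h1 := h a
    have h2 := h b
    rw [← hx', hx, botRel_coe] at h1
    rw [← hy', hy, botRel_coe] at h2
    obtain ⟨z, hz⟩ := Option.ne_none_iff_exists'.1 (hs.linked a b x' y' hne hx'.symm hy'.symm)
    obtain ⟨z', hz', -⟩ := hθ.compat hz h1 h2
    simp [hz']
  refine ⟨hgood, fun c => ?_⟩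
  by_cases hc : s c = ⊥
  · have := h c
    rw [hc, botRel_bot_left] at this
    rw [close_eq_bot hc, close_eq_bot this]
    exact Or.inl ⟨rfl, rfl⟩
  · obtain ⟨x, hx⟩ := WithBot.ne_bot_iff_exists.1 hc
    rcases hs.close_cases hx.symm with ⟨h0, h'⟩ | ⟨d, y, z, hne, hy, hz, h'⟩
    · rw [h', hx, close_eq_self (s := t)]
      · exact h c
      · intro d hd
        have := h d
        rwa [h0 d hd, botRel_bot_left] at this
    · have h1 := h c
      have h2 := h d
      rw [← hx, botRel_coe_left] at h1
      rw [hy, botRel_coe_left] at h2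
      obtain ⟨x', hx', h1⟩ := h1
      obtain ⟨y', hy', h2⟩ := h2
      obtain ⟨z', hz', hzz⟩ := hθ.compat hz h1 h2
      rw [h', hgood.close_eq hne hx' hy' hz', botRel_coe]
      exact hzz

theorem LinkCon.isLatCon_glue (hθ : S.LinkCon θ) : IsLatCon (glue (S := S) θ) := by
  refine ⟨⟨?_, ?_, ?_⟩, ?_, ?_⟩
  · intro m
    rcases eq_top_or m with rfl | ⟨s, hs, rfl⟩
    · exact Or.inl ⟨rfl, rfl⟩
    · exact glue_tuple.2 fun c => botRel_refl (hθ.con c) _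
  · rintro m n (⟨rfl, rfl⟩ | ⟨s, t, hs, ht, rfl, rfl, h⟩)
    · exact Or.inl ⟨rfl, rfl⟩
    · exact glue_tuple.2 fun c => botRel_symm (hθ.con c) (h c)
  · rintro m n k (⟨rfl, rfl⟩ | ⟨s, t, hs, ht, rfl, rfl, h⟩)
    · exact id
    · rintro (⟨h', -⟩ | ⟨t', q, ht', hq, h', rfl, h''⟩)
      · exact absurd h' tuple_ne_top
      · rw [tuple_inj] at h'
        subst h'
        exact glue_tuple.2 fun c => botRel_trans (hθ.con c) (h c) (h'' c)
  · rintro m n k l (⟨rfl, rfl⟩ | ⟨s, t, hs, ht, rfl, rfl, h⟩) hkl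
    · rwa [top_inf_eq, top_inf_eq]
    · rcases hkl with ⟨rfl, rfl⟩ | ⟨s', t', hs', ht', rfl, rfl, h'⟩
      · rw [inf_top_eq, inf_top_eq]
        exact glue_tuple.2 h
      · rw [tuple_inf_tuple, tuple_inf_tuple]
        exact glue_tuple.2 fun c => botRel_inf (hθ.con c) (h c) (h' c)
  · rintro m n k l (⟨rfl, rfl⟩ | ⟨s, t, hs, ht, rfl, rfl, h⟩) hkl
    · rw [top_sup_eq, top_sup_eq]
      exact Or.inl ⟨rfl, rfl⟩
    · rcases hkl with ⟨rfl, rfl⟩ | ⟨s', t', hs', ht', rfl, rfl, h'⟩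
      · rw [sup_top_eq, sup_top_eq]
        exact Or.inl ⟨rfl, rfl⟩
      · have hst : ∀ c, botRel (θ c) ((s ⊔ s') c) ((t ⊔ t') c) := fun c =>
          botRel_sup (hθ.con c) (h c) (h' c)
        by_cases hg : S.Good (s ⊔ s')
        · obtain ⟨hg', hcl⟩ := hg.of_botRel hθ hst
          rw [tuple_sup_tuple hg, tuple_sup_tuple hg', glue_tuple]
          exact hcl
        · have hg' : ¬ S.Good (t ⊔ t') := fun hg' =>
            hg (hg'.of_botRel hθ fun c => botRel_symm (hθ.con c) (hst c)).1
          rw [tuple_sup_tuple_of_not_good hg, tuple_sup_tuple_of_not_good hg']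
          exact Or.inl ⟨rfl, rfl⟩

end glue

theorem countable_sum [Countable Γ] [∀ c, Countable (D c)] : Countable S.Sum := by
  let v : Option (Σ c, D c) → S.Sum := fun o => o.elim ⊥ fun a => base a.1 a.2
  let φ : Option (Option (Σ c, D c) × Option (Σ c, D c)) → S.Sum :=
    fun o => o.elim ⊤ fun a => v a.1 ⊔ v a.2
  refine Function.Surjective.countable (f := φ) fun m => ?_
  rcases eq_top_or m with rfl | ⟨s, hs, rfl⟩
  · exact ⟨none, rfl⟩
  rcases tuple_cases s hs with h | ⟨c, x, -, -, h⟩ | ⟨c, d, x, y, -, -, -, h⟩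
  · exact ⟨some (none, none), by simp [φ, v, h]⟩
  · exact ⟨some (some ⟨c, x⟩, none), by simp [φ, v, h]⟩
  · exact ⟨some (some ⟨c, x⟩, some ⟨d, y⟩), by simp [φ, v, h]⟩

end LinkSystem

/-! ### N₆-quadruples -/

theorem isN6_of_inf_sup {L : Type*} [Lattice L] {o i a₁ b₁ a₂ b₂ : L} (h₁ : a₁ < b₁) (h₂ : a₂ < b₂)
    (ho : a₁ ⊓ a₂ = o) (ho' : b₁ ⊓ b₂ = o) (hi : a₁ ⊔ a₂ = i) (hi' : b₁ ⊔ b₂ = i)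
    (ho₁ : o ≠ a₁) (ho₂ : o ≠ a₂) (hi₁ : i ≠ b₁) (hi₂ : i ≠ b₂) : IsN6 a₁ b₁ a₂ b₂ := by
  have hoa₁ : o ≤ a₁ := ho ▸ inf_le_left
  have hoa₂ : o ≤ a₂ := ho ▸ inf_le_right
  have hbi₁ : b₁ ≤ i := hi' ▸ le_sup_left
  have hbi₂ : b₂ ≤ i := hi' ▸ le_sup_right
  have hob₁ := hoa₁.trans h₁.le
  have hob₂ := hoa₂.trans h₂.le
  have hai₁ := h₁.le.trans hbi₁
  have hai₂ := h₂.le.trans hbi₂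
  have hoi := hoa₁.trans hai₁
  have m1 : a₁ ⊓ b₂ = o :=
    le_antisymm (ho' ▸ inf_le_inf_right _ h₁.le) (le_inf hoa₁ hob₂)
  have m2 : b₁ ⊓ a₂ = o :=
    le_antisymm (ho' ▸ inf_le_inf_left _ h₂.le) (le_inf hob₁ hoa₂)
  have j1 : a₁ ⊔ b₂ = i :=
    le_antisymm (sup_le hai₁ hbi₂) (hi ▸ sup_le_sup_left h₂.le _)
  have j2 : b₁ ⊔ a₂ = i :=
    le_antisymm (sup_le hbi₁ hai₂) (hi ▸ sup_le_sup_right h₁.le _)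
  refine ⟨h₁, h₂, ho.trans ho'.symm, hi.trans hi'.symm, ?_, ?_, ?_⟩
  · have e1 : a₁ ≠ a₂ := fun h => ho₁ (by rw [← ho, ← h, inf_idem])
    have e2 : a₁ ≠ b₂ := fun h => ho₂ (by rw [← ho, h, inf_eq_right.2 h₂.le])
    have e3 : b₁ ≠ a₂ := fun h => ho₁ (by rw [← ho, ← h, inf_eq_left.2 h₁.le])
    have e4 : b₁ ≠ b₂ := fun h => hi₁ (by rw [← hi', ← h, sup_idem])
    have e5 : o ≠ b₁ := ((hoa₁.lt_of_ne ho₁).trans h₁).ne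
    have e6 : o ≠ b₂ := ((hoa₂.lt_of_ne ho₂).trans h₂).ne
    have e7 : a₁ ≠ i := (h₁.trans_le hbi₁).ne
    have e8 : a₂ ≠ i := (h₂.trans_le hbi₂).ne
    have e9 : o ≠ i := ((hoa₁.lt_of_ne ho₁).trans_le hai₁).ne
    classical
    rw [ho, hi]
    have : ({o, a₁, b₁, a₂, b₂, i} : Set L) = (({o, a₁, b₁, a₂, b₂, i} : Finset L) : Set L) := by
      simp
    rw [this, Set.ncard_coe_finset]
    have := h₁.ne
    have := h₂.ne
    simp [Finset.card_insert_of_notMem, *, hi₁.symm, hi₂.symm]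
  · rw [ho, hi]
    rintro x (rfl | rfl | rfl | rfl | rfl | rfl) y (rfl | rfl | rfl | rfl | rfl | rfl) <;>
      simp [*, h₁.le, h₂.le, (sup_comm _ _).trans hi, (sup_comm _ _).trans hi',
        (sup_comm _ _).trans j1, (sup_comm _ _).trans j2]
  · rw [ho, hi]
    rintro x (rfl | rfl | rfl | rfl | rfl | rfl) y (rfl | rfl | rfl | rfl | rfl | rfl) <;>
      simp [*, h₁.le, h₂.le, (inf_comm _ _).trans ho, (inf_comm _ _).trans ho',
        (inf_comm _ _).trans m1, (inf_comm _ _).trans m2]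

theorem IsN6.map {L M : Type*} [Lattice L] [Lattice M] {a₁ b₁ a₂ b₂ : L} (h : IsN6 a₁ b₁ a₂ b₂)
    (f : L → M) (hf : Function.Injective f) (hinf : ∀ x y, f (x ⊓ y) = f x ⊓ f y)
    (hsup : ∀ x y, f (x ⊔ y) = f x ⊔ f y) : IsN6 (f a₁) (f b₁) (f a₂) (f b₂) := by
  have hlt : ∀ {x y}, x < y → f x < f y := fun {x y} hxy =>
    lt_of_le_of_ne (by rw [← sup_eq_right, ← hsup, sup_eq_right.2 hxy.le]) (hf.ne hxy.ne)
  obtain ⟨h₁, h₂, h₃, h₄, h₅, h₆, h₇⟩ := h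
  have himg : ({f a₁ ⊓ f a₂, f a₁, f b₁, f a₂, f b₂, f a₁ ⊔ f a₂} : Set M) =
      f '' {a₁ ⊓ a₂, a₁, b₁, a₂, b₂, a₁ ⊔ a₂} := by
    simp only [Set.image_insert_eq, Set.image_singleton, hinf, hsup]
  refine ⟨hlt h₁, hlt h₂, by rw [← hinf, ← hinf, h₃], by rw [← hsup, ← hsup, h₄], ?_, ?_, ?_⟩
  · rw [himg, Set.ncard_image_of_injective _ hf, h₅]
  · rw [himg]
    rintro _ ⟨x, hx, rfl⟩ _ ⟨y, hy, rfl⟩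
    exact ⟨x ⊔ y, h₆ hx hy, hsup x y⟩
  · rw [himg]
    rintro _ ⟨x, hx, rfl⟩ _ ⟨y, hy, rfl⟩
    exact ⟨x ⊓ y, h₇ hx hy, hinf x y⟩

namespace LinkSystem

variable {Γ : Type w} {D : Γ → Type u} [∀ c, Lattice (D c)] {S : LinkSystem Γ D}

open LinkSystem.Sum

variable {c d : Γ} (hne : c ≠ d) (hl : ∀ x y, S.link c d x y = none)
include hne hl

theorem isN6_of_not_linked {x x' : D c} {y y' : D d} (hx : x < x') (hy : y < y') :
    IsN6 (base c x : S.Sum) (base c x') (base d y) (base d y') :=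
  isN6_of_inf_sup (base_lt_base.2 hx) (base_lt_base.2 hy) (base_inf_base_of_ne hne x y)
    (base_inf_base_of_ne hne x' y') (base_sup_eq_top hne (hl x y)) (base_sup_eq_top hne (hl x' y'))
    base_ne_bot.symm base_ne_bot.symm base_ne_top.symm base_ne_top.symm

theorem isStrongN6_of_not_linked {x x' : D c} {y y' : D d} (hx : x < x') (hy : y < y') :
    IsStrongN6 (base c x : S.Sum) (base c x') (base d y) (base d y') := by
  have hb := base_inf_base_of_ne (S := S) hne x' y'
  have ht := base_sup_eq_top hne (hl x y)
  have hl' : ∀ y x, S.link d c y x = none := fun y x => S.link_symm (hl x y)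
  refine ⟨⟨isN6_of_not_linked hne hl hx hy, by rw [hb]; exact isBot_bot, by rw [ht]; exact isTop_top⟩,
    ?_, ?_, ?_, ?_⟩
  · intro m h1 h2
    rcases le_base_iff.1 h2 with rfl | ⟨z, -, rfl⟩
    · exact absurd h1 not_lt_bot
    · rw [ht, base_sup_eq_top hne (hl _ _)]
  · intro m h1 h2
    rcases le_base_iff.1 h2 with rfl | ⟨z, -, rfl⟩
    · exact absurd h1 not_lt_bot
    · rw [ht, base_sup_eq_top hne.symm (hl' _ _)]
  · intro m h1 h2
    rw [hb]
    refine inf_base_eq_bot (fun z hz => ?_) y'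
    obtain ⟨v, hv, -⟩ := closed_link (h2.trans_le le_top).ne hne h1 hz
    simp [hl] at hv
  · intro m h1 h2
    rw [hb]
    refine inf_base_eq_bot (fun z hz => ?_) x'
    obtain ⟨v, hv, -⟩ := closed_link (h2.trans_le le_top).ne hne.symm h1 hz
    simp [hl'] at hv

end LinkSystem

/-! ### Congruences given by down-sets of colors -/

namespace AuxStr

variable {L H : Type*} [Lattice L] (A : AuxStr L H)

theorem delta_le_eps (p : H) : A.δ p ≤ A.ε p := by
  by_cases hp : p = A.zero
  · rw [hp, A.delta_zero]
  · exact (A.delta_covby p hp).le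

theorem nu_iff {p q : H} : A.ν p q ↔ cg (A.δ q) (A.ε q) (A.δ p) (A.ε p) := by
  constructor
  · intro h
    refine A.quasi.2.2.2.1 _ _ _ _ (A.delta_le_eps p) (A.delta_le_eps q) ?_ _ _ (cg_self _ _)
    rwa [A.gamma_delta, A.gamma_delta]
  · intro h
    have := A.quasi.2.2.2.2 _ _ _ _ (A.delta_le_eps p) (A.delta_le_eps q)
      fun x y hxy => hxy _ (cg_isLatCon _ _) h
    rwa [A.gamma_delta, A.gamma_delta] at this

theorem cg_gamma {x y : L} (h : x ≤ y) (r : L → L → Prop) (hr : IsLatCon r) :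
    r (A.δ (A.γ x y)) (A.ε (A.γ x y)) ↔ r x y := by
  have hν : ∀ p, A.ν p p := A.quasi.1
  constructor
  · intro h'
    refine A.quasi.2.2.2.1 _ _ _ _ h (A.delta_le_eps (A.γ x y)) ?_ _ _ (cg_self _ _) r hr h'
    rw [A.gamma_delta]
    exact hν _
  · intro h'
    refine A.quasi.2.2.2.1 _ _ _ _ (A.delta_le_eps (A.γ x y)) h ?_ _ _ (cg_self _ _) r hr h'
    rw [A.gamma_delta]
    exact hν _

/-- The join of the congruences whose colors lie in `U`. -/
def downCon (U : Set H) : L → L → Prop :=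
  Relation.EqvGen fun a b => ∃ p ∈ U, cg (A.δ p) (A.ε p) a b

variable {A}

theorem downCon_of_mem {U : Set H} {p : H} (hp : p ∈ U) : A.downCon U (A.δ p) (A.ε p) :=
  Relation.EqvGen.rel _ _ ⟨p, hp, cg_self _ _⟩

theorem downCon_map {U : Set H} (φ : L → L)
    (hφ : ∀ r : L → L → Prop, IsLatCon r → ∀ a b, r a b → r (φ a) (φ b)) {a b : L}
    (h : A.downCon U a b) : A.downCon U (φ a) (φ b) := by
  induction h with
  | rel x y h =>
    obtain ⟨p, hp, h⟩ := h
    exact Relation.EqvGen.rel _ _ ⟨p, hp, hφ _ (cg_isLatCon _ _) _ _ h⟩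
  | refl x => exact Relation.EqvGen.refl _
  | symm x y _ ih => exact Relation.EqvGen.symm _ _ ih
  | trans x y z _ _ ih ih' => exact Relation.EqvGen.trans _ _ _ ih ih'

theorem isLatCon_downCon (U : Set H) : IsLatCon (A.downCon U) := by
  refine ⟨Relation.EqvGen.is_equivalence _, ?_, ?_⟩
  · intro a b c d h h'
    exact Relation.EqvGen.trans _ _ _
      (downCon_map (· ⊓ c) (fun r hr _ _ h => hr.inf h (hr.refl c)) h)
      (downCon_map (b ⊓ ·) (fun r hr _ _ h => hr.inf (hr.refl b) h) h')
  · intro a b c d h h'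
    exact Relation.EqvGen.trans _ _ _
      (downCon_map (· ⊔ c) (fun r hr _ _ h => hr.sup h (hr.refl c)) h)
      (downCon_map (b ⊔ ·) (fun r hr _ _ h => hr.sup (hr.refl b) h) h')

theorem mem_of_downCon {U : Set H} (hz : A.zero ∈ U) (hU : ∀ p q, A.ν p q → q ∈ U → p ∈ U) {p : H}
    (h : A.downCon U (A.δ p) (A.ε p)) : p ∈ U := by
  by_cases hp : p = A.zero
  · rwa [hp]
  have hcov := A.delta_covby p hp
  have hle := A.delta_le_eps p
  let φ : L → L := fun z => (z ⊔ A.δ p) ⊓ A.ε p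
  have hφ : ∀ z, φ z = A.δ p ∨ φ z = A.ε p := by
    intro z
    have h1 : A.δ p ≤ φ z := le_inf le_sup_right hle
    exact hcov.eq_or_eq h1 inf_le_right
  have key : ∀ a b, A.downCon U a b → φ a ≠ φ b → p ∈ U := by
    intro a b hab
    induction hab with
    | rel x y h =>
      intro hne
      obtain ⟨q, hq, h⟩ := h
      have hr := cg_isLatCon (A.δ q) (A.ε q)
      have h' : cg (A.δ q) (A.ε q) (φ x) (φ y) :=
        hr.inf (hr.sup h (hr.refl _)) (hr.refl _)
      refine hU p q (A.nu_iff.2 ?_) hq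
      rcases hφ x with hx | hx <;> rcases hφ y with hy | hy
      · exact absurd (hx.trans hy.symm) hne
      · rwa [hx, hy] at h'
      · rw [hx, hy] at h'
        exact hr.symm h'
      · exact absurd (hx.trans hy.symm) hne
    | refl x => exact fun h => absurd rfl h
    | symm x y _ ih => exact fun h => ih h.symm
    | trans x y z _ _ ih ih' =>
      intro hne
      by_cases hxy : φ x = φ y
      · exact ih' (hxy ▸ hne)
      · exact ih hxy
  refine key _ _ h ?_
  have e1 : φ (A.δ p) = A.δ p := by simp [φ, hle]
  have e2 : φ (A.ε p) = A.ε p := by simp [φ]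
  rw [e1, e2]
  exact hcov.ne

end AuxStr

/-! ### The extension -/

namespace ColorExt

/-- The components of the extension: the given lattice, a two-element chain realizing a color and
a two-element chain transporting it for every color, and four one-element components. -/
inductive Comp (Q : Type w) : Type w
  | main : Comp Q
  | chain : Q → Comp Q
  | edge : Q → Comp Q
  | cap : Comp Q
  | iso : Fin 3 → Comp Q

/-- The lattices at the components. -/
def Fam (L : Type u) {Q : Type w} : Comp Q → Type u
  | .main => L
  | .chain _ => ULift.{u} Bool
  | .edge _ => ULift.{u} Bool
  | .cap => PUnit
  | .iso _ => PUnit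

noncomputable instance {L : Type u} [Lattice L] {Q : Type w} : ∀ c : Comp Q, Lattice (Fam L c)
  | .main => inferInstanceAs (Lattice L)
  | .chain _ => inferInstanceAs (Lattice (ULift.{u} Bool))
  | .edge _ => inferInstanceAs (Lattice (ULift.{u} Bool))
  | .cap => inferInstanceAs (Lattice PUnit)
  | .iso _ => inferInstanceAs (Lattice PUnit)

section Selection

variable {L : Type u} [Lattice L]

/-- The bottom of the two-element chain. -/
abbrev lo : ULift.{u} Bool := ⟨false⟩

/-- The top of the two-element chain. -/
abbrev hi : ULift.{u} Bool := ⟨true⟩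

/-- One of the two members of a pair. -/
def sel (w : L × L) (b : ULift.{u} Bool) : L := bif b.down then w.2 else w.1

open Classical in
/-- Whether joining with the first member of a pair reaches above the second one. -/
noncomputable def det (w : L × L) (b : ULift.{u} Bool) (x : L) : ULift.{u} Bool :=
  ⟨b.down || decide (w.2 ≤ x ⊔ w.1)⟩

variable {w : L × L}

theorem lo_le (b : ULift.{u} Bool) : lo ≤ b := Bool.false_le b.down

theorem le_hi (b : ULift.{u} Bool) : b ≤ hi := Bool.le_true b.down

theorem lo_lt_hi : lo.{u} < hi := Bool.false_lt_true

theorem eq_lo_or_eq_hi (b : ULift.{u} Bool) : b = lo ∨ b = hi := by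
  rcases b with ⟨_ | _⟩
  exacts [Or.inl rfl, Or.inr rfl]

theorem lo_covBy_hi : lo.{u} ⋖ hi := by
  refine ⟨lo_lt_hi.{u}, fun c h1 h2 => ?_⟩
  rcases eq_lo_or_eq_hi c with rfl | rfl
  exacts [lt_irrefl _ h1, lt_irrefl _ h2]

theorem lo_ne_hi : lo.{u} ≠ hi := lo_lt_hi.ne

omit [Lattice L] in
theorem sel_lo : sel w lo = w.1 := rfl

theorem det_hi (x : L) : det w hi x = hi := by simp [det]

theorem det_lo_of_le {x : L} (h : w.2 ≤ x ⊔ w.1) : det w lo x = hi := by simp [det, h]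

theorem det_lo_of_not_le {x : L} (h : ¬ w.2 ≤ x ⊔ w.1) : det w lo x = lo := by simp [det, h]

theorem sel_mono (hw : w.1 ≤ w.2) {b b' : ULift.{u} Bool} (h : b ≤ b') : sel w b ≤ sel w b' := by
  rcases eq_lo_or_eq_hi b with rfl | rfl <;> rcases eq_lo_or_eq_hi b' with rfl | rfl
  · exact le_rfl
  · exact hw
  · exact absurd h (not_le_of_gt lo_lt_hi.{u})
  · exact le_rfl

theorem le_det (b : ULift.{u} Bool) (x : L) : b ≤ det w b x := by
  rcases eq_lo_or_eq_hi b with rfl | rfl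
  · exact lo_le _
  · rw [det_hi]

theorem det_mono {b b' : ULift.{u} Bool} (h : b ≤ b') {x x' : L} (hx : x ≤ x') :
    det w b x ≤ det w b' x' := by
  rcases eq_lo_or_eq_hi b' with rfl | rfl
  · rcases eq_lo_or_eq_hi b with rfl | rfl
    · by_cases h : w.2 ≤ x ⊔ w.1
      · rw [det_lo_of_le h, det_lo_of_le (h.trans (sup_le_sup_right hx _))]
      · rw [det_lo_of_not_le h]
        exact lo_le _
    · exact absurd h (not_le_of_gt lo_lt_hi.{u})
  · rw [det_hi]
    exact le_hi _

theorem sel_det_le (b : ULift.{u} Bool) (x : L) :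
    sel w (det w b x) ≤ x ⊔ sel w b := by
  rcases eq_lo_or_eq_hi b with rfl | rfl
  · by_cases h : w.2 ≤ x ⊔ w.1
    · rw [det_lo_of_le h]; exact h
    · rw [det_lo_of_not_le h]; exact le_sup_right
  · rw [det_hi]; exact le_sup_right

theorem det_det (b : ULift.{u} Bool) (x : L) :
    det w (det w b x) (x ⊔ sel w b) = det w b x := by
  rcases eq_lo_or_eq_hi b with rfl | rfl
  · by_cases h : w.2 ≤ x ⊔ w.1
    · rw [det_lo_of_le h, det_hi]
    · rw [det_lo_of_not_le h, det_lo_of_not_le]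
      rwa [sel_lo, sup_assoc, sup_idem]
  · rw [det_hi, det_hi]

end Selection

variable {L : Type u} [Lattice L] {Q : Type w} [PartialOrder Q]

open Classical in
/-- The links between the components; `pr p` is the pair of color `p` in the given lattice, if
there is one, and `t` is the color of the full congruence. -/
noncomputable def lnk (pr : Q → Option (L × L)) (t : Q) :
    ∀ c c' : Comp Q, Fam L c → Fam L c' → Option (Fam L c)
  | .main, .edge p, (x : L), b => (pr p).map fun w => x ⊔ sel w b
  | .edge p, .main, b, (x : L) => (pr p).map fun w => det w b x
  | .chain p, .edge q, (b : ULift Bool), (b' : ULift Bool) => if p = q then some (b ⊔ b') else none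
  | .edge q, .chain p, (b : ULift Bool), (b' : ULift Bool) => if p = q then some (b ⊔ b') else none
  | .edge p, .edge q, (b : ULift Bool), (b' : ULift Bool) =>
      if p < q then some (b ⊔ b') else if q < p then some b else none
  | .chain p, .cap, (b : ULift Bool), _ => if p = t ∧ b = lo then some b else none
  | .cap, .chain p, x, (b : ULift Bool) => if p = t ∧ b = lo then some x else none
  | _, _, _, _ => none

theorem sup_sup_swap {α : Type*} [Lattice α] (x y : α) : x ⊔ y ⊔ (y ⊔ x) = x ⊔ y := by
  rw [sup_comm y x, sup_idem]

theorem sup_sup_right {α : Type*} [Lattice α] (x y : α) : x ⊔ y ⊔ y = x ⊔ y := by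
  rw [sup_assoc, sup_idem]

/-- The link system of the extension. -/
noncomputable def sys (pr : Q → Option (L × L)) (hpr : ∀ p w, pr p = some w → w.1 ≤ w.2) (t : Q) :
    LinkSystem (Comp Q) (Fam L) where
  link := lnk pr t
  link_symm := by
    rintro (_ | p | p | _ | j) (_ | q | q | _ | k) x y h <;> simp only [lnk] at h ⊢
    case main.edge => exact Option.map_eq_none_iff.2 (Option.map_eq_none_iff.1 h)
    case edge.main => exact Option.map_eq_none_iff.2 (Option.map_eq_none_iff.1 h)
    case chain.edge => simpa using h
    case edge.chain => simpa using h
    case chain.cap => simpa using h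
    case cap.chain => simpa using h
    case edge.edge =>
      split_ifs at h ⊢ with h1 h2; simp_all
  le_link := by
    rintro (_ | p | p | _ | j) (_ | q | q | _ | k) x y z h <;> simp only [lnk] at h
    case main.edge =>
      obtain ⟨w, -, rfl⟩ := Option.map_eq_some_iff.1 h
      exact le_sup_left (α := L)
    case edge.main =>
      obtain ⟨w, -, rfl⟩ := Option.map_eq_some_iff.1 h
      exact le_det _ _
    case edge.edge =>
      split_ifs at h <;> cases h
      exacts [le_sup_left (α := ULift Bool), le_refl (α := ULift Bool) _]
    case chain.edge => split_ifs at h; cases h; exact le_sup_left (α := ULift Bool)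
    case edge.chain => split_ifs at h; cases h; exact le_sup_left (α := ULift Bool)
    case chain.cap => split_ifs at h; cases h; exact le_refl (α := ULift Bool) _
    case cap.chain => split_ifs at h; cases h; exact le_refl (α := PUnit) _
    all_goals cases h
  link_mono := by
    rintro (_ | p | p | _ | j) (_ | q | q | _ | k) x x' y y' z' hx hy h <;> simp only [lnk] at h ⊢
    case main.edge =>
      obtain ⟨w, hw, rfl⟩ := Option.map_eq_some_iff.1 h
      exact ⟨_, by rw [hw]; rfl, sup_le_sup (α := L) hx (sel_mono (hpr _ _ hw) hy)⟩
    case edge.main =>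
      obtain ⟨w, hw, rfl⟩ := Option.map_eq_some_iff.1 h
      exact ⟨_, by rw [hw]; rfl, det_mono hx hy⟩
    case edge.edge =>
      split_ifs at h ⊢ <;> cases h
      exacts [⟨_, rfl, sup_le_sup (α := ULift Bool) hx hy⟩, ⟨_, rfl, hx⟩]
    case chain.cap =>
      split_ifs at h with h1
      cases h
      have : x = lo := le_antisymm (α := ULift Bool) (h1.2 ▸ hx) (lo_le _)
      rw [if_pos ⟨h1.1, this⟩]
      exact ⟨_, rfl, hx⟩
    case cap.chain =>
      split_ifs at h with h1
      cases h
      have : y = lo := le_antisymm (α := ULift Bool) (h1.2 ▸ hy) (lo_le _)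
      rw [if_pos ⟨h1.1, this⟩]
      exact ⟨_, rfl, hx⟩
    case chain.edge =>
      split_ifs at h ⊢
      cases h
      exact ⟨_, rfl, sup_le_sup (α := ULift Bool) hx hy⟩
    case edge.chain =>
      split_ifs at h ⊢
      cases h
      exact ⟨_, rfl, sup_le_sup (α := ULift Bool) hx hy⟩
    all_goals cases h
  link_link := by
    rintro (_ | p | p | _ | j) (_ | q | q | _ | k) x z y w h h' <;> simp only [lnk] at h h' ⊢
    case main.edge =>
      obtain ⟨v, hv, rfl⟩ := Option.map_eq_some_iff.1 h
      rw [hv] at h' ⊢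
      cases h'
      exact congrArg some (sup_eq_left (α := L).2 (sel_det_le _ _))
    case edge.main =>
      obtain ⟨v, hv, rfl⟩ := Option.map_eq_some_iff.1 h
      rw [hv] at h' ⊢
      cases h'
      exact congrArg some (det_det _ _)
    case edge.edge =>
      split_ifs at h h' ⊢ with h1 h2
      · exact absurd (h1.trans h2) (lt_irrefl _)
      · cases h; cases h'
        exact congrArg some (sup_sup_right (α := ULift Bool) x y)
      · cases h; cases h'; rfl
    case chain.edge =>
      split_ifs at h h' ⊢
      cases h; cases h'
      exact congrArg some (sup_sup_swap (α := ULift Bool) x y)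
    case edge.chain =>
      split_ifs at h h' ⊢
      cases h; cases h'
      exact congrArg some (sup_sup_swap (α := ULift Bool) x y)
    case chain.cap =>
      split_ifs at h with h1
      cases h
      rw [if_pos h1]
    case cap.chain =>
      split_ifs at h h' with h1
      cases h; cases h'
      rw [if_pos h1]
    all_goals cases h

end ColorExt

/-- An embedding of the colors of an auxiliary structure as an order ideal. -/
structure IdealEmb {L : Type u} {H : Type v} [Lattice L] (A : AuxStr L H) (K : Type w)
    [PartialOrder K] where
  toFun : H → K
  inj : Function.Injective toFun
  le_iff : ∀ x y, A.ν x y ↔ toFun x ≤ toFun y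
  ideal : ∀ (x : H) (y : K), y ≤ toFun x → ∃ z, toFun z = y

namespace IdealEmb

open ColorExt LinkSystem LinkSystem.Sum

variable {L : Type u} {H : Type v} [Lattice L] {A : AuxStr L H} {K : Type w} [PartialOrder K]
  [BoundedOrder K] (E : IdealEmb A K)

theorem map_zero : E.toFun A.zero = ⊥ := by
  obtain ⟨z, hz⟩ := E.ideal A.zero ⊥ bot_le
  have := (E.le_iff A.zero z).1 (A.zero_least z)
  rw [hz] at this
  exact le_bot_iff.1 this

theorem map_eq_bot {a : H} : E.toFun a = ⊥ ↔ a = A.zero := by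
  rw [← E.map_zero, E.inj.eq_iff]

/-- The pair coloring a color of the given structure. -/
def prime (A : AuxStr L H) (a : H) : L × L := (A.δ a, A.ε a)

open Classical in
/-- The pair of a color, if the color comes from the given structure. -/
noncomputable def pr (p : {p : K // p ≠ ⊥}) : Option (L × L) :=
  if h : ∃ a, E.toFun a = p then some (prime A h.choose) else none

theorem pr_map {a : H} (h : E.toFun a ≠ ⊥) : E.pr ⟨E.toFun a, h⟩ = some (prime A a) := by
  have h' : ∃ b, E.toFun b = E.toFun a := ⟨a, rfl⟩
  rw [pr, dif_pos h', E.inj h'.choose_spec]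

theorem pr_eq_some {p : {p : K // p ≠ ⊥}} {w : L × L} (h : E.pr p = some w) :
    ∃ a, E.toFun a = p ∧ w = prime A a := by
  unfold pr at h
  split_ifs at h with h'
  exact ⟨_, h'.choose_spec, (Option.some_inj.1 h).symm⟩

variable [Nontrivial K]

/-- The link system of the extension. -/
noncomputable def sys : LinkSystem (Comp {p : K // p ≠ ⊥}) (Fam L) :=
  ColorExt.sys E.pr (fun p w h => by
    obtain ⟨a, -, rfl⟩ := E.pr_eq_some h
    exact A.delta_le_eps a) ⟨⊤, top_ne_bot⟩

section Links

variable {p q : {p : K // p ≠ ⊥}} {a : H}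

theorem link_main_edge (h : E.toFun a ≠ ⊥) (x : L) (b : ULift.{u} Bool) :
    E.sys.link .main (.edge ⟨E.toFun a, h⟩) x b = some (x ⊔ sel (prime A a) b) :=
  congrArg (Option.map fun w => x ⊔ sel w b) (E.pr_map h)

theorem link_edge_main (h : E.toFun a ≠ ⊥) (b : ULift.{u} Bool) (x : L) :
    E.sys.link (.edge ⟨E.toFun a, h⟩) .main b x = some (det (prime A a) b x) :=
  congrArg (Option.map fun w => det w b x) (E.pr_map h)

theorem link_chain_edge (b b' : ULift.{u} Bool) :
    E.sys.link (.chain p) (.edge p) b b' = some (b ⊔ b' : ULift.{u} Bool) := if_pos rfl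

theorem link_edge_chain (b b' : ULift.{u} Bool) :
    E.sys.link (.edge p) (.chain p) b b' = some (b ⊔ b' : ULift.{u} Bool) := if_pos rfl

theorem link_edge_edge (h : p < q) (b b' : ULift.{u} Bool) :
    E.sys.link (.edge p) (.edge q) b b' = some (b ⊔ b' : ULift.{u} Bool) := if_pos h

theorem link_cap_chain_lo : E.sys.link .cap (.chain ⟨⊤, top_ne_bot⟩) PUnit.unit lo
    = some PUnit.unit := if_pos ⟨rfl, rfl⟩

theorem link_chain_cap_lo : E.sys.link (.chain ⟨⊤, top_ne_bot⟩) .cap lo PUnit.unit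
    = some lo := if_pos ⟨rfl, rfl⟩

theorem link_cap_chain_hi : E.sys.link .cap (.chain ⟨⊤, top_ne_bot⟩) PUnit.unit hi = none :=
  if_neg fun h => lo_ne_hi h.2.symm

/-- The three isolated elements of the extension. -/
noncomputable def points : E.sys.Points where
  idx := .iso
  idx_inj _ _ h := Comp.iso.inj h
  pt _ := PUnit.unit
  eq_pt _ _ := rfl
  link_eq j c y _ := by rcases c with _ | _ | _ | _ | _ <;> rfl

end Links

open Classical in
/-- The elements `δ p` and `ε p` of the extension. -/
noncomputable def elt (b : ULift.{u} Bool) (p : K) : E.sys.Sum :=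
  if h : ∃ a, E.toFun a = p then base .main (sel (prime A h.choose) b : L)
  else base (.chain ⟨p, fun hp => h ⟨A.zero, E.map_zero.trans hp.symm⟩⟩) b

theorem elt_map (b : ULift.{u} Bool) (a : H) :
    E.elt b (E.toFun a) = base .main (sel (prime A a) b : L) := by
  have h' : ∃ b, E.toFun b = E.toFun a := ⟨a, rfl⟩
  rw [elt, dif_pos h', E.inj h'.choose_spec]

theorem elt_of_not {p : K} (h : ¬ ∃ a, E.toFun a = p) (hp : p ≠ ⊥) (b : ULift.{u} Bool) :
    E.elt b p = base (.chain ⟨p, hp⟩) b := dif_neg h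

omit [Nontrivial K] in
theorem not_mem_cases (p : K) : (∃ a, E.toFun a = p) ∨ ((¬ ∃ a, E.toFun a = p) ∧ p ≠ ⊥) := by
  by_cases h : ∃ a, E.toFun a = p
  · exact Or.inl h
  · exact Or.inr ⟨h, fun hp => h ⟨A.zero, E.map_zero.trans hp.symm⟩⟩

theorem elt_eq_of_eq_bot {p : K} (hp : p = ⊥) (b b' : ULift.{u} Bool) :
    E.elt b p = E.elt b' p := by
  obtain rfl : p = E.toFun A.zero := hp.trans E.map_zero.symm
  rw [elt_map, elt_map]
  have : ∀ b, sel (prime A A.zero) b = A.δ A.zero := by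
    intro b
    rcases eq_lo_or_eq_hi b with rfl | rfl
    exacts [rfl, A.delta_zero.symm]
  rw [this, this]

theorem elt_covBy {p : K} (hp : p ≠ ⊥) : E.elt lo p ⋖ E.elt hi p := by
  rcases E.not_mem_cases p with ⟨a, rfl⟩ | ⟨h, -⟩
  · rw [elt_map, elt_map]
    exact base_covBy_base (A.delta_covby a (E.map_eq_bot.not.1 hp))
  · rw [E.elt_of_not h hp, E.elt_of_not h hp]
    exact base_covBy_base lo_covBy_hi

theorem elt_le (p : K) : E.elt lo p ≤ E.elt hi p := by
  by_cases hp : p = ⊥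
  · rw [E.elt_eq_of_eq_bot hp lo hi]
  · exact (E.elt_covBy hp).le

section Transfer

variable {r : E.sys.Sum → E.sys.Sum → Prop} (hr : IsLatCon r)
include hr

theorem con_chain_iff_edge (p : {p : K // p ≠ ⊥}) :
    r (base (.chain p) lo) (base (.chain p) hi) ↔ r (base (.edge p) lo) (base (.edge p) hi) :=
  ⟨fun h => con_transfer hr (by simp) (E.link_edge_chain lo lo) (E.link_edge_chain lo hi) h,
    fun h => con_transfer hr (by simp) (E.link_chain_edge lo lo) (E.link_chain_edge lo hi) h⟩

theorem con_elt_iff_edge {p : K} (hp : p ≠ ⊥) :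
    r (E.elt lo p) (E.elt hi p) ↔ r (base (.edge ⟨p, hp⟩) lo) (base (.edge ⟨p, hp⟩) hi) := by
  rcases E.not_mem_cases p with ⟨a, rfl⟩ | ⟨h, -⟩
  · have ha := A.delta_covby a (E.map_eq_bot.not.1 hp)
    rw [elt_map, elt_map]
    constructor
    · intro h
      have h1 := E.link_edge_main hp lo (A.δ a)
      have h2 := E.link_edge_main hp lo (A.ε a)
      rw [det_lo_of_not_le (by rw [prime, sup_idem]; exact ha.lt.not_ge)] at h1
      rw [det_lo_of_le (by exact le_sup_left)] at h2
      exact con_transfer hr (by simp) h1 h2 h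
    · intro h
      have h1 := E.link_main_edge hp (A.δ a) lo
      have h2 := E.link_main_edge hp (A.δ a) hi
      rw [show A.δ a ⊔ sel (prime A a) lo = sel (prime A a) lo from sup_idem _] at h1
      rw [show A.δ a ⊔ sel (prime A a) hi = sel (prime A a) hi from sup_eq_right.2 ha.le] at h2
      exact con_transfer hr (by simp) h1 h2 h
  · rw [E.elt_of_not h hp, E.elt_of_not h hp]
    exact E.con_chain_iff_edge hr _

theorem con_elt_mono {p q : K} (hpq : p ≤ q) (h : r (E.elt lo q) (E.elt hi q)) :
    r (E.elt lo p) (E.elt hi p) := by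
  by_cases hp : p = ⊥
  · rw [E.elt_eq_of_eq_bot hp lo hi]
    exact hr.refl _
  rcases hpq.eq_or_lt with rfl | hlt
  · exact h
  have hq : q ≠ ⊥ := (bot_le.trans_lt hlt).ne'
  rw [E.con_elt_iff_edge hr hp]
  rw [E.con_elt_iff_edge hr hq] at h
  have hlt' : (⟨p, hp⟩ : {p : K // p ≠ ⊥}) < ⟨q, hq⟩ := hlt
  refine con_transfer hr ?_ (E.link_edge_edge hlt' lo lo) (E.link_edge_edge hlt' lo hi) h
  simpa using hlt.ne

theorem con_elt_top (h : r (E.elt lo ⊤) (E.elt hi ⊤)) : r ⊥ ⊤ := by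
  rw [E.con_elt_iff_edge hr top_ne_bot, ← E.con_chain_iff_edge hr] at h
  refine E.points.full_of_top hr ?_ (con_transfer_top hr (by simp) E.link_cap_chain_hi h)
  exact (base_sup_base_of_link (by simp) E.link_cap_chain_lo E.link_chain_cap_lo).1

end Transfer

end IdealEmb

namespace IdealEmb

open ColorExt LinkSystem LinkSystem.Sum

variable {L : Type u} {H : Type v} [Lattice L] {A : AuxStr L H} {K : Type w} [PartialOrder K]
  [BoundedOrder K] (E : IdealEmb A K)

/-- The congruences of the components collapsing exactly the colors in `U`. -/
def compCon (U : Set K) : ∀ c : Comp {p : K // p ≠ ⊥}, Fam L c → Fam L c → Prop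
  | .main => A.downCon {a | E.toFun a ∈ U}
  | .chain p => fun x y => x = y ∨ p.1 ∈ U
  | .edge p => fun x y => x = y ∨ p.1 ∈ U
  | .cap => fun x y => x = y
  | .iso _ => fun x y => x = y

theorem isLatCon_eq_or {α : Type*} [Lattice α] (P : Prop) : IsLatCon fun x y : α => x = y ∨ P := by
  by_cases h : P
  · simpa [h] using IsLatCon.all
  · simpa [h] using IsLatCon.eq

theorem isLatCon_compCon (U : Set K) (c : Comp {p : K // p ≠ ⊥}) :
    IsLatCon (E.compCon U c) := by
  rcases c with _ | p | p | _ | j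
  · exact AuxStr.isLatCon_downCon _
  · exact isLatCon_eq_or (α := ULift.{u} Bool) (p.1 ∈ U)
  · exact isLatCon_eq_or (α := ULift.{u} Bool) (p.1 ∈ U)
  · exact IsLatCon.eq (L := PUnit)
  · exact IsLatCon.eq (L := PUnit)

variable {U : Set K} (hbot : ⊥ ∈ U) (hlow : IsLowerSet U)
include hbot hlow

theorem mem_of_compCon_main {a : H}
    (h : A.downCon {a | E.toFun a ∈ U} (A.δ a) (A.ε a)) : E.toFun a ∈ U :=
  AuxStr.mem_of_downCon (U := {a | E.toFun a ∈ U}) (by simpa [E.map_zero] using hbot)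
    (fun _ _ hpq hq => hlow ((E.le_iff _ _).1 hpq) hq) h

theorem eps_le_of_downCon {a : H} (ha : E.toFun a ∉ U) {x x' : L}
    (h : A.downCon {a | E.toFun a ∈ U} x x') (hx : A.ε a ≤ x ⊔ A.δ a) : A.ε a ≤ x' ⊔ A.δ a := by
  have hr : IsLatCon (A.downCon {a | E.toFun a ∈ U}) := AuxStr.isLatCon_downCon _
  have ha0 : a ≠ A.zero := fun h0 => ha (by rw [h0, E.map_zero]; exact hbot)
  have hcov := A.delta_covby a ha0
  have h' := hr.inf (hr.sup h (hr.refl (A.δ a))) (hr.refl (A.ε a))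
  rw [inf_eq_right.2 hx] at h'
  rcases hcov.eq_or_eq (le_inf le_sup_right hcov.le : A.δ a ≤ (x' ⊔ A.δ a) ⊓ A.ε a)
    inf_le_right with h1 | h1
  · rw [h1] at h'
    exact absurd (E.mem_of_compCon_main hbot hlow (hr.symm h')) ha
  · exact inf_eq_right.1 h1

theorem det_eq_of_downCon {a : H} (ha : E.toFun a ∉ U) {x x' : L}
    (h : A.downCon {a | E.toFun a ∈ U} x x') (b : ULift.{u} Bool) :
    det (prime A a) b x = det (prime A a) b x' := by
  have hr : IsLatCon (A.downCon {a | E.toFun a ∈ U}) := AuxStr.isLatCon_downCon _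
  rcases eq_lo_or_eq_hi b with rfl | rfl
  · by_cases hx : A.ε a ≤ x ⊔ A.δ a
    · rw [det_lo_of_le hx, det_lo_of_le (E.eps_le_of_downCon hbot hlow ha h hx)]
    · rw [det_lo_of_not_le hx, det_lo_of_not_le fun hx' =>
        hx (E.eps_le_of_downCon hbot hlow ha (hr.symm h) hx')]
  · rw [det_hi, det_hi]

variable [Nontrivial K] (htop : ⊤ ∉ U)
include htop

theorem linkCon_compCon : E.sys.LinkCon (E.compCon U) := by
  refine ⟨E.isLatCon_compCon U, ?_⟩
  rintro (_ | p | p | _ | j) (_ | q | q | _ | k) x x' z y y' h hx hy <;>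
    simp only [sys, ColorExt.sys, lnk] at h ⊢
  case main.edge =>
    obtain ⟨w, hw, rfl⟩ := Option.map_eq_some_iff.1 h
    rw [hw]
    refine ⟨_, rfl, ?_⟩
    obtain ⟨a, ha, rfl⟩ := E.pr_eq_some hw
    have hr : IsLatCon (A.downCon {a | E.toFun a ∈ U}) := AuxStr.isLatCon_downCon _
    refine hr.sup hx ?_
    rcases hy with rfl | hq
    · exact hr.refl _
    · have hm : A.downCon {a | E.toFun a ∈ U} (A.δ a) (A.ε a) :=
        AuxStr.downCon_of_mem (by rw [Set.mem_ofPred_eq, ha]; exact hq)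
      rcases eq_lo_or_eq_hi y with rfl | rfl <;> rcases eq_lo_or_eq_hi y' with rfl | rfl
      exacts [hr.refl _, hm, hr.symm hm, hr.refl _]
  case edge.main =>
    obtain ⟨w, hw, rfl⟩ := Option.map_eq_some_iff.1 h
    rw [hw]
    refine ⟨_, rfl, ?_⟩
    obtain ⟨a, ha, rfl⟩ := E.pr_eq_some hw
    by_cases hp : p.1 ∈ U
    · exact Or.inr hp
    · rcases hx with rfl | hx
      · rw [← ha] at hp
        exact Or.inl (E.det_eq_of_downCon hbot hlow hp hy _)
      · exact absurd hx hp
  case edge.edge =>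
    split_ifs at h ⊢ with h1 h2 <;> cases h
    · refine ⟨_, rfl, ?_⟩
      by_cases hp : p.1 ∈ U
      · exact Or.inr hp
      · have hq : q.1 ∉ U := fun hq => hp (hlow h1.le hq)
        rcases hx with rfl | hx
        · rcases hy with rfl | hy
          · exact Or.inl rfl
          · exact absurd hy hq
        · exact absurd hx hp
    · exact ⟨_, rfl, hx⟩
  case chain.edge =>
    split_ifs at h ⊢ with h1
    cases h
    subst h1
    refine ⟨_, rfl, ?_⟩
    rcases hx with rfl | hx
    · rcases hy with rfl | hy
      exacts [Or.inl rfl, Or.inr hy]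
    · exact Or.inr hx
  case edge.chain =>
    split_ifs at h ⊢ with h1
    cases h
    subst h1
    refine ⟨_, rfl, ?_⟩
    rcases hx with rfl | hx
    · rcases hy with rfl | hy
      exacts [Or.inl rfl, Or.inr hy]
    · exact Or.inr hx
  case chain.cap =>
    split_ifs at h with h1
    cases h
    rcases hx with rfl | hx
    · rw [if_pos h1]
      exact ⟨_, rfl, Or.inl rfl⟩
    · rw [h1.1] at hx
      exact absurd hx htop
  case cap.chain =>
    split_ifs at h with h1
    cases h
    rcases hy with rfl | hy
    · rw [if_pos h1]
      exact ⟨_, rfl, hx⟩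
    · rw [h1.1] at hy
      exact absurd hy htop
  all_goals cases h

omit htop in
theorem glue_elt_iff {p : K} :
    glue (S := E.sys) (E.compCon U) (E.elt lo p) (E.elt hi p) ↔ p ∈ U := by
  rcases E.not_mem_cases p with ⟨a, rfl⟩ | ⟨h, hp⟩
  · rw [elt_map, elt_map]
    refine glue_base.trans ⟨fun h => E.mem_of_compCon_main hbot hlow h, fun h => ?_⟩
    exact AuxStr.downCon_of_mem (U := {a | E.toFun a ∈ U}) h
  · rw [E.elt_of_not h hp, E.elt_of_not h hp]
    refine glue_base.trans ⟨fun h => ?_, Or.inr⟩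
    exact h.resolve_left lo_ne_hi

omit hbot hlow htop

theorem le_iff_con {p q : K} : p ≤ q ↔ ∀ r : E.sys.Sum → E.sys.Sum → Prop, IsLatCon r →
    r (E.elt lo q) (E.elt hi q) → r (E.elt lo p) (E.elt hi p) := by
  refine ⟨fun h r hr hq => E.con_elt_mono hr h hq, fun h => ?_⟩
  by_cases hq : q = ⊤
  · exact hq ▸ le_top
  have hb : (⊥ : K) ∈ Set.Iic q := bot_le
  have ht : (⊤ : K) ∉ Set.Iic q := fun h' => hq (top_le_iff.1 h')
  have hl : IsLowerSet (Set.Iic q) := isLowerSet_Iic q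
  exact (E.glue_elt_iff hb hl).1 (h _ (E.linkCon_compCon hb hl ht).isLatCon_glue
    ((E.glue_elt_iff hb hl).2 (le_refl q)))

theorem eq_of_con {p q : K} (h : ∀ r : E.sys.Sum → E.sys.Sum → Prop, IsLatCon r →
    (r (E.elt lo p) (E.elt hi p) ↔ r (E.elt lo q) (E.elt hi q))) : p = q :=
  le_antisymm (E.le_iff_con.2 fun r hr => (h r hr).2) (E.le_iff_con.2 fun r hr => (h r hr).1)

/-- `p` is the color of the pair `(s, t)`. -/
def IsColor (s t : E.sys.Sum) (p : K) : Prop :=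
  ∀ r : E.sys.Sum → E.sys.Sum → Prop, IsLatCon r → (r s t ↔ r (E.elt lo p) (E.elt hi p))

theorem isColor_self (s : E.sys.Sum) : E.IsColor s s ⊥ := fun r hr =>
  iff_of_true (hr.refl _) (by rw [E.elt_eq_of_eq_bot rfl lo hi]; exact hr.refl _)

theorem isColor_main {x x' : L} (h : x ≤ x') :
    E.IsColor (base .main x) (base .main x') (E.toFun (A.γ x x')) := by
  intro r hr
  rw [elt_map, elt_map]
  exact (A.cg_gamma h (fun x y : L => r (base .main x) (base .main y))
    (hr.comap (fun x : L => base .main x) (fun x y => (base_inf_base (S := E.sys) _ _ _).symm)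
      fun x y => (base_sup_base (S := E.sys) _ _ _).symm)).symm

theorem exists_isColor_bool {c : Comp {p : K // p ≠ ⊥}} (f : ULift.{u} Bool → Fam L c) {p : K}
    (hp : E.IsColor (base c (f lo)) (base c (f hi)) p) {b b' : ULift.{u} Bool} (h : b ≤ b') :
    ∃ p, E.IsColor (base c (f b)) (base c (f b')) p := by
  rcases eq_lo_or_eq_hi b with rfl | rfl <;> rcases eq_lo_or_eq_hi b' with rfl | rfl
  · exact ⟨_, E.isColor_self _⟩
  · exact ⟨p, hp⟩
  · exact absurd h (not_le_of_gt lo_lt_hi.{u})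
  · exact ⟨_, E.isColor_self _⟩

theorem exists_isColor_base {c : Comp {p : K // p ≠ ⊥}} {x x' : Fam L c} (h : x ≤ x') :
    ∃ p, E.IsColor (base c x) (base c x') p := by
  rcases c with _ | p | p | _ | j
  · exact ⟨_, E.isColor_main h⟩
  · exact E.exists_isColor_bool (c := .chain p) id (p := p.1) (fun r hr =>
      (E.con_chain_iff_edge hr p).trans (E.con_elt_iff_edge hr p.2).symm) h
  · exact E.exists_isColor_bool (c := .edge p) id (p := p.1) (fun r hr =>
      (E.con_elt_iff_edge hr p.2).symm) h
  · exact ⟨_, E.isColor_self _⟩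
  · exact ⟨_, E.isColor_self _⟩

theorem link_comparable {c d : Comp {p : K // p ≠ ⊥}} {x x' : Fam L c} {y y' : Fam L d}
    (hx : x ≤ x') (hy : y ≤ y') (h : E.sys.link c d x' y' = some x')
    (h' : E.sys.link d c y' x' = some y') :
    x = x' ∨ y = y' ∨ E.sys.link d c y x' = some y' ∨ E.sys.link c d x y' = some x' := by
  have hb : ∀ {b b' : ULift.{u} Bool}, b ≤ b' → b = b' ∨ b = lo ∧ b' = hi := by
    intro b b' hb
    rcases eq_lo_or_eq_hi b with rfl | rfl <;> rcases eq_lo_or_eq_hi b' with rfl | rfl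
    · exact Or.inl rfl
    · exact Or.inr ⟨rfl, rfl⟩
    · exact absurd hb (not_le_of_gt lo_lt_hi.{u})
    · exact Or.inl rfl
  have hs : ∀ b : ULift.{u} Bool, b ⊔ hi = hi := fun b => sup_eq_right.2 (le_hi b)
  rcases c with _ | p | p | _ | j <;> rcases d with _ | q | q | _ | k <;>
    simp only [sys, ColorExt.sys, lnk] at h h' ⊢
  case main.edge =>
    rcases hb hy with rfl | ⟨rfl, rfl⟩
    · exact Or.inr (Or.inl rfl)
    obtain ⟨w, hw, hx'⟩ := Option.map_eq_some_iff.1 h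
    rw [hw]
    exact Or.inr (Or.inr (Or.inl (congrArg some
      (det_lo_of_le ((sup_eq_left.1 hx').trans le_sup_left)))))
  case edge.main =>
    rcases hb hx with rfl | ⟨rfl, rfl⟩
    · exact Or.inl rfl
    obtain ⟨w, hw, hy'⟩ := Option.map_eq_some_iff.1 h'
    rw [hw]
    exact Or.inr (Or.inr (Or.inr (congrArg some
      (det_lo_of_le ((sup_eq_left.1 hy').trans le_sup_left)))))
  case chain.edge =>
    split_ifs at h h' ⊢
    rcases hb hy with rfl | ⟨rfl, rfl⟩
    · exact Or.inr (Or.inl rfl)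
    have := (Option.some_inj.1 h).symm.trans (hs x')
    subst this
    exact Or.inr (Or.inr (Or.inl rfl))
  case edge.chain =>
    split_ifs at h h' ⊢
    rcases hb hy with rfl | ⟨rfl, rfl⟩
    · exact Or.inr (Or.inl rfl)
    have := (Option.some_inj.1 h).symm.trans (hs x')
    subst this
    exact Or.inr (Or.inr (Or.inl rfl))
  case edge.edge =>
    split_ifs at h h' ⊢ with h1 h2
    · exact absurd (h1.trans h2) (lt_irrefl _)
    · rcases hb hx with rfl | ⟨rfl, rfl⟩
      · exact Or.inl rfl
      have := (Option.some_inj.1 h').symm.trans (hs y')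
      subst this
      exact Or.inr (Or.inr (Or.inl (congrArg some (hs y))))
    · rcases hb hy with rfl | ⟨rfl, rfl⟩
      · exact Or.inr (Or.inl rfl)
      have := (Option.some_inj.1 h).symm.trans (hs x')
      subst this
      exact Or.inr (Or.inr (Or.inr (congrArg some (hs x))))
  case chain.cap => exact Or.inr (Or.inl rfl)
  case cap.chain => exact Or.inl rfl
  all_goals cases h

theorem exists_isColor {s t : E.sys.Sum} (hst : s ≤ t) : ∃ p, E.IsColor s t p := by
  rcases pair_cases E.points hst with rfl | h | ⟨c, x, x', hx, rfl, rfl⟩ |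
    ⟨c, d, x, x', y, y', hne, hx, hy, h1, h2, h3, h4, rfl, rfl⟩
  · exact ⟨⊥, E.isColor_self _⟩
  · exact ⟨⊤, fun r hr => ⟨fun h' => con_full hr (h r hr h') _ _,
      fun h' => con_full hr (E.con_elt_top hr h') _ _⟩⟩
  · exact E.exists_isColor_base hx
  · obtain ⟨p, hp⟩ := E.exists_isColor_base hx
    obtain ⟨q, hq⟩ := E.exists_isColor_base hy
    have key : ∀ r, IsLatCon r → _ := fun r hr =>
      con_pair_iff (S := E.sys) (r := r) hr hne hx hy h1 h2 h3 h4
    rcases E.link_comparable hx hy h3 h4 with rfl | rfl | h | h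
    · exact ⟨q, fun r hr => by rw [key r hr, ← hq r hr]; exact and_iff_right (hr.refl _)⟩
    · exact ⟨p, fun r hr => by rw [key r hr, ← hp r hr]; exact and_iff_left (hr.refl _)⟩
    · refine ⟨p, fun r hr => ?_⟩
      rw [key r hr, ← hp r hr]
      exact and_iff_left_of_imp (con_transfer hr hne.symm h2 h)
    · refine ⟨q, fun r hr => ?_⟩
      rw [key r hr, ← hq r hr]
      exact and_iff_right_of_imp (con_transfer hr hne h1 h)

end IdealEmb

namespace IdealEmb

open ColorExt LinkSystem LinkSystem.Sum

variable {L : Type u} {H : Type v} [Lattice L] {A : AuxStr L H} {K : Type w} [PartialOrder K]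
  [BoundedOrder K] [Nontrivial K] (E : IdealEmb A K)

open Classical in
/-- The coloring of the extension. -/
noncomputable def color (s t : E.sys.Sum) : K :=
  if h : s ≤ t then (E.exists_isColor h).choose else ⊥

theorem isColor_color {s t : E.sys.Sum} (h : s ≤ t) : E.IsColor s t (E.color s t) := by
  rw [color, dif_pos h]
  exact (E.exists_isColor h).choose_spec

theorem color_eq {s t : E.sys.Sum} (h : s ≤ t) {p : K} (hp : E.IsColor s t p) :
    E.color s t = p :=
  E.eq_of_con fun r hr => (E.isColor_color h r hr).symm.trans (hp r hr)

theorem color_elt (p : K) : E.color (E.elt lo p) (E.elt hi p) = p :=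
  E.color_eq (E.elt_le p) fun _ _ => Iff.rfl

theorem link_main_chain (p : {p : K // p ≠ ⊥}) (x : Fam L .main) (y : Fam L (.chain p)) :
    E.sys.link .main (.chain p) x y = none := rfl

theorem link_chain_main (p : {p : K // p ≠ ⊥}) (y : Fam L (.chain p)) (x : Fam L .main) :
    E.sys.link (.chain p) .main y x = none := rfl

theorem link_chain_chain (p q : {p : K // p ≠ ⊥}) (x : Fam L (.chain p)) (y : Fam L (.chain q)) :
    E.sys.link (.chain p) (.chain q) x y = none := rfl

theorem elt_cases {p q : K} (hp : p ≠ ⊥) (hq : q ≠ ⊥) (hpq : p ≠ q) :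
    (∃ a b, E.toFun a = p ∧ E.toFun b = q) ∨
      IsStrongN6 (E.elt lo p) (E.elt hi p) (E.elt lo q) (E.elt hi q) := by
  rcases E.not_mem_cases p with ⟨a, rfl⟩ | ⟨hp', -⟩ <;>
    rcases E.not_mem_cases q with ⟨b, rfl⟩ | ⟨hq', -⟩
  · exact Or.inl ⟨a, b, rfl, rfl⟩
  · rw [elt_map, elt_map, E.elt_of_not hq' hq, E.elt_of_not hq' hq]
    exact Or.inr (isStrongN6_of_not_linked (by simp) (E.link_main_chain ⟨q, hq⟩)
      (A.delta_covby a (E.map_eq_bot.not.1 hp)).lt lo_lt_hi.{u})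
  · rw [elt_map, elt_map, E.elt_of_not hp' hp, E.elt_of_not hp' hp]
    exact Or.inr (isStrongN6_of_not_linked (by simp) (E.link_chain_main ⟨p, hp⟩)
      lo_lt_hi.{u} (A.delta_covby b (E.map_eq_bot.not.1 hq)).lt)
  · rw [E.elt_of_not hp' hp, E.elt_of_not hp' hp, E.elt_of_not hq' hq, E.elt_of_not hq' hq]
    exact Or.inr (isStrongN6_of_not_linked (by simpa using hpq)
      (E.link_chain_chain ⟨p, hp⟩ ⟨q, hq⟩) lo_lt_hi.{u} lo_lt_hi.{u})

theorem isQuasiColored_color : IsQuasiColored E.color (fun p q : K => p ≤ q) := by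
  refine ⟨fun p => le_refl p, fun p q r => le_trans, fun p => ⟨_, _, E.elt_le p, E.color_elt p⟩,
    ?_, ?_⟩
  · intro s t s' t' h h' hle x y hxy r hr hr'
    exact hxy r hr ((E.isColor_color h r hr).2
      (E.con_elt_mono hr hle ((E.isColor_color h' r hr).1 hr')))
  · intro s t s' t' h h' hcg
    refine E.le_iff_con.2 fun r hr hr' => (E.isColor_color h r hr).1 ?_
    exact hcg s t (cg_self _ _) r hr ((E.isColor_color h' r hr).2 hr')

/-- The extension of an auxiliary structure to a bounded ordered set of colors. -/
noncomputable def extend : AuxStr E.sys.Sum K where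
  γ := E.color
  ν p q := p ≤ q
  δ := E.elt lo
  ε := E.elt hi
  zero := ⊥
  quasi := E.isQuasiColored_color
  zero_least _ := bot_le
  least_unique z hz := le_bot_iff.1 (hz ⊥)
  greatest_unique p q hp hq := le_antisymm (hq p) (hp q)
  delta_zero := E.elt_eq_of_eq_bot rfl lo hi
  delta_covby p hp := E.elt_covBy hp
  gamma_delta := E.color_elt
  n6 p q hp hq hpq := by
    rcases E.elt_cases hp hq hpq with ⟨a, b, rfl, rfl⟩ | h
    · rw [elt_map, elt_map, elt_map, elt_map]
      exact (A.n6 a b (E.map_eq_bot.not.1 hp) (E.map_eq_bot.not.1 hq)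
        fun h => hpq (congrArg _ h)).map (fun x : L => (base .main x : E.sys.Sum))
        (fun x y h => base_inj.1 h) (fun x y => (base_inf_base _ _ _).symm)
        fun x y => (base_sup_base _ _ _).symm
    · exact h.1.1
  strong p q hpq hqp h := by
    rcases E.elt_cases (p := p) (q := q) (fun h => hpq (h ▸ bot_le)) (fun h => hqp (h ▸ bot_le))
      (fun h => hpq h.le) with ⟨a, b, rfl, rfl⟩ | h'
    · have hb := isBot_iff_eq_bot.1 h.2.1
      rw [elt_map, elt_map] at hb
      exact absurd ((base_inf_base _ _ _).symm.trans hb) base_ne_bot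
    · exact h'
  atoms3 s t hs ht _ := by
    obtain rfl := isBot_iff_eq_bot.1 hs
    obtain rfl := isTop_iff_eq_top.1 ht
    have key : ∀ j, ⊥ ⋖ E.points.elt j ∧ E.points.elt j ⋖ ⊤ ∧ ∀ y : E.sys.Sum, y ≠ ⊥ → y ≠ ⊤ →
        y ≠ E.points.elt j → E.points.elt j ⊓ y = ⊥ ∧ E.points.elt j ⊔ y = ⊤ := fun j =>
      ⟨E.points.bot_covBy j, E.points.covBy_top j, fun y hb ht hne =>
        ⟨inf_comm y _ ▸ E.points.inf_elt ht hne, sup_comm y _ ▸ E.points.sup_elt hb hne⟩⟩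
    refine ⟨E.points.elt 0, E.points.elt 1, E.points.elt 2, E.points.elt_inj.ne (by decide),
      E.points.elt_inj.ne (by decide), E.points.elt_inj.ne (by decide), ?_⟩
    rintro x (rfl | rfl | rfl)
    exacts [key 0, key 1, key 2]
  notfull one hone _ := by
    obtain rfl : one = ⊤ := top_le_iff.1 (hone ⊤)
    refine ⟨⊥, ⊤, fun h => ?_⟩
    have hb : (⊥ : K) ∈ {p : K | p ≠ ⊤} := bot_ne_top
    have ht : (⊤ : K) ∉ {p : K | p ≠ ⊤} := fun h => h rfl
    have hl : IsLowerSet {p : K | p ≠ ⊤} := fun p q hqp hp hq => hp (top_le_iff.1 (hq ▸ hqp))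
    refine not_glue_bot_top (h _ (E.linkCon_compCon hb hl ht).isLatCon_glue ?_)
    rintro _ ⟨p, hp, rfl⟩
    exact (E.glue_elt_iff hb hl).2 hp

/-- The given structure is a substructure of its extension. -/
noncomputable def auxSub : AuxSub A E.extend where
  f x := base .main x
  g := E.toFun
  f_inj _ _ h := base_inj.1 h
  g_inj := E.inj
  f_inf _ _ := (base_inf_base _ _ _).symm
  f_sup _ _ := (base_sup_base _ _ _).symm
  g_zero := E.map_zero
  nu_mono x y := (E.le_iff x y).1
  gamma_comm _ _ h := E.color_eq (base_le_base.2 h) (E.isColor_main h)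
  delta_comm a := (E.elt_map lo a).symm
  eps_comm a := (E.elt_map hi a).symm

instance [Countable K] : Countable (Comp {p : K // p ≠ ⊥}) := by
  let φ : Option (Option ({p : K // p ≠ ⊥} ⊕ {p : K // p ≠ ⊥}) ⊕ Fin 3) →
      Comp {p : K // p ≠ ⊥}
    | none => .main
    | some (.inl none) => .cap
    | some (.inl (some (.inl p))) => .chain p
    | some (.inl (some (.inr p))) => .edge p
    | some (.inr j) => .iso j
  refine Function.Surjective.countable (f := φ) ?_
  rintro (_ | p | p | _ | j)
  exacts [⟨none, rfl⟩, ⟨some (.inl (some (.inl p))), rfl⟩, ⟨some (.inl (some (.inr p))), rfl⟩,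
    ⟨some (.inl none), rfl⟩, ⟨some (.inr j), rfl⟩]

theorem countable_extend [Countable L] [Countable K] : Countable E.sys.Sum := by
  have : ∀ c : Comp {p : K // p ≠ ⊥}, Countable (Fam L c) := by
    rintro (_ | p | p | _ | j)
    exacts [‹Countable L›, inferInstanceAs (Countable (ULift Bool)),
      inferInstanceAs (Countable (ULift Bool)), inferInstanceAs (Countable PUnit),
      inferInstanceAs (Countable PUnit)]
  exact countable_sum

end IdealEmb

/-! ### The degenerate case -/

/-- The one-element auxiliary structure. -/
def trivialAuxStr {K : Type w} [Subsingleton K] (p : K) (ν : K → K → Prop) (hν : Reflexive ν) :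
    AuxStr PUnit.{u + 1} K where
  γ _ _ := p
  ν := ν
  δ _ := PUnit.unit
  ε _ := PUnit.unit
  zero := p
  quasi := ⟨hν, fun x y z hxy hyz => Subsingleton.elim y z ▸ hxy,
    fun q => ⟨PUnit.unit, PUnit.unit, le_rfl, Subsingleton.elim p q⟩,
    fun _ _ _ _ _ _ _ _ _ _ _ hr _ => hr.refl _, fun _ _ _ _ _ _ _ => hν p⟩
  zero_least q := Subsingleton.elim p q ▸ hν p
  least_unique q _ := Subsingleton.elim q p
  greatest_unique q q' _ _ := Subsingleton.elim q q'
  delta_zero := rfl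
  delta_covby q hq := absurd (Subsingleton.elim q p) hq
  gamma_delta q := Subsingleton.elim p q
  n6 q _ hq _ _ := absurd (Subsingleton.elim q p) hq
  strong q q' h _ _ := absurd (Subsingleton.elim q q' ▸ hν q) h
  atoms3 _ _ _ _ h := absurd rfl h
  notfull _ _ h := by
    obtain ⟨a, b, h⟩ := h
    exact absurd rfl h

theorem AuxStr.subsingleton {L : Type u} {H : Type v} [Lattice L] [Subsingleton H]
    (A : AuxStr L H) : Subsingleton L := by
  have key : ∀ a b : L, a ≤ b → a = b := fun a b h => by
    refine (A.cg_gamma h _ IsLatCon.eq).1 ?_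
    rw [Subsingleton.elim (A.γ a b) A.zero, A.delta_zero]
  exact ⟨fun a b => (key _ _ inf_le_left).symm.trans (key _ _ inf_le_right)⟩


/-- Combined extension (Lemma 4.2): if the color set `(H; ν)` of an auxiliary structure
is (via `g`) an order ideal of a bounded ordered set `(H'; ν')`, then there is an
auxiliary structure extension whose quasiordered color set is exactly `(H'; ν')`;
countability is preserved. -/
theorem stmt17 {L : Type u} {H : Type v} {H' : Type w} [Lattice L]
    (A : AuxStr L H)
    (hanti : ∀ x y : H, A.ν x y → A.ν y x → x = y)
    (ν' : H' → H' → Prop)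
    (hrefl : Reflexive ν') (htrans : Transitive ν')
    (hanti' : ∀ x y : H', ν' x y → ν' y x → x = y)
    (bot top : H') (hbot : ∀ x : H', ν' bot x) (htop : ∀ x : H', ν' x top)
    (g : H → H') (ginj : Function.Injective g)
    (hgiso : ∀ x y : H, A.ν x y ↔ ν' (g x) (g y))
    (hideal : ∀ (x : H) (y : H'), ν' y (g x) → ∃ z : H, g z = y) :
    ∃ (L' : Type (max u w)) (_ : Lattice L') (B : AuxStr L' H') (sub : AuxSub A B),
      B.ν = ν' ∧ sub.g = g ∧
      (Countable L ∧ Countable H → Countable H' → Countable L' ∧ Countable H') := by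
  by_cases hbt : bot = top
  · have hsub : Subsingleton H' := ⟨fun x y => hanti' x y
      (htrans (htop x) (hbt ▸ hbot y)) (htrans (htop y) (hbt ▸ hbot x))⟩
    have hsubH : Subsingleton H := ginj.subsingleton
    have hsubL : Subsingleton L := A.subsingleton
    exact ⟨PUnit, inferInstance, trivialAuxStr bot ν' hrefl,
      { f := fun _ => PUnit.unit
        g := g
        f_inj := fun x y _ => Subsingleton.elim x y
        g_inj := ginj
        f_inf := fun _ _ => rfl
        f_sup := fun _ _ => rfl
        g_zero := Subsingleton.elim _ _
        nu_mono := fun x y => (hgiso x y).1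
        gamma_comm := fun _ _ _ => Subsingleton.elim _ _
        delta_comm := fun _ => rfl
        eps_comm := fun _ => rfl }, rfl, rfl, fun _ h => ⟨inferInstance, h⟩⟩
  · let _ : PartialOrder H' :=
      { le := ν'
        le_refl := hrefl
        le_trans := fun _ _ _ h h' => htrans h h'
        le_antisymm := fun x y => hanti' x y }
    let _ : BoundedOrder H' :=
      { bot := bot
        bot_le := hbot
        top := top
        le_top := htop }
    have : Nontrivial H' := ⟨bot, top, hbt⟩
    let E : IdealEmb A H' := ⟨g, ginj, hgiso, hideal⟩
    exact ⟨E.sys.Sum, inferInstance, E.extend, E.auxSub, rfl, rfl, fun ⟨_, _⟩ _ =>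
      ⟨E.countable_extend, inferInstance⟩⟩
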